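/- arXiv:2512.09499 — 2 statements merged into one kernel-verified Lean document; each statement's English description precedes it below -/
import Mathlib

section
/- Let X, Y ⊆ [0,1]^d, let μ ∈ P(X), ν ∈ P(Y), and let n ≥ 3. Set τ = d^{p/4} n^{−1/(max{2d,4})} log n. Let π̂_{τ,n} be the optimal coupling for the entropic OT problem S_{p,τ}(μ̂_n, ν̂_n), and let κ̂_n be the Markov kernel obtained by disintegrating π̂_{τ,n} in its first argument, extended to all x ∈ ℝ^d via the entropic-potential formula dκ̂_n(y|x) ∝ exp((g_τ(y) − ‖x−y‖^p)/τ) dν̂_n(y). Then there is a constant C_{p,d} depending only on p and d such that E[E_p(κ̂_n; μ, ν)] ≤ C_{p,d} · n^{−1/(max{2pd, 4p})} · (log n)². -/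
open MeasureTheory ProbabilityTheory Set
open scoped ENNReal NNReal

noncomputable section

abbrev Rd (d : ℕ) : Type := EuclideanSpace ℝ (Fin d)

/-- `π` is a coupling of `μ` and `ν`. -/
def IsCoupling {d : ℕ} (π : Measure (Rd d × Rd d)) (μ ν : Measure (Rd d)) : Prop :=
  π.map Prod.fst = μ ∧ π.map Prod.snd = ν

/-- The `p`-Wasserstein distance between `μ` and `ν`. -/
noncomputable def Wp {d : ℕ} (p : ℝ) (μ ν : Measure (Rd d)) : ℝ :=
  sInf { c : ℝ | ∃ π : Measure (Rd d × Rd d), IsCoupling π μ ν ∧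
    c = (∫ z, ‖z.1 - z.2‖ ^ p ∂π) ^ (1 / p) }

/-- The transport cost `(∫∫ ‖x-y‖^p dκ_x(y) dμ(x))^{1/p}` of a kernel. -/
noncomputable def kernelCost {d : ℕ} (p : ℝ) (κ : Kernel (Rd d) (Rd d))
    (μ : Measure (Rd d)) : ℝ :=
  (∫ x, ∫ y, ‖x - y‖ ^ p ∂(κ x) ∂μ) ^ (1 / p)

/-- Pushforward of `μ` by the kernel `κ`. -/
noncomputable def kpush {d : ℕ} (κ : Kernel (Rd d) (Rd d)) (μ : Measure (Rd d)) :
    Measure (Rd d) :=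
  μ.bind fun x => κ x

/-- The transportation error `E_p(κ; μ, ν)`: optimality gap plus feasibility gap. -/
noncomputable def Ep {d : ℕ} (p : ℝ) (κ : Kernel (Rd d) (Rd d)) (μ ν : Measure (Rd d)) : ℝ :=
  max (kernelCost p κ μ - Wp p μ ν) 0 + Wp p (kpush κ μ) ν

/-- Total variation distance between measures. -/
noncomputable def tvDist {α : Type*} [MeasurableSpace α] (μ ν : Measure α) : ℝ :=
  sSup { r : ℝ | ∃ A : Set α, MeasurableSet A ∧ r = |(μ A).toReal - (ν A).toReal| }

/-- Finite `p`-th moment. -/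
def HasFiniteMoment {d : ℕ} (p : ℝ) (μ : Measure (Rd d)) : Prop :=
  Integrable (fun x => ‖x‖ ^ p) μ


/-- Empirical measure of `n` points. -/
noncomputable def empMeasure {d n : ℕ} (xs : Fin n → Rd d) : Measure (Rd d) :=
  (n : ℝ≥0∞)⁻¹ • ∑ i : Fin n, Measure.dirac (xs i)

/-- (Real-valued) Kullback–Leibler divergence `∫ log(dπ/dσ) dπ`. -/
noncomputable def klDivR {α : Type*} [MeasurableSpace α] (π σ : Measure α) : ℝ :=
  ∫ z, Real.log ((π.rnDeriv σ) z).toReal ∂π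

/-- The entropic OT objective `∫∫‖x−y‖^p dπ + τ KL(π‖μ⊗ν)`. -/
noncomputable def entObj {d : ℕ} (p τ : ℝ) (π base : Measure (Rd d × Rd d)) : ℝ :=
  (∫ z, ‖z.1 - z.2‖ ^ p ∂π) + τ * klDivR π base

/-- The coupling `dπ(x,y) = dμ(x) dκ(y|x)` induced by a kernel and a source measure. -/
noncomputable def kernelCoupling {d : ℕ} (κ : Kernel (Rd d) (Rd d)) (μ : Measure (Rd d)) :
    Measure (Rd d × Rd d) :=
  μ.bind fun x => (κ x).map (fun y => (x, y))

/-- The unit cube `[0,1]^d`. -/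
def cube01 (d : ℕ) : Set (Rd d) := {x | ∀ i, x i ∈ Icc (0 : ℝ) 1}

/-- For `b ≥ 0`, the map `t ↦ t ^ p` is `p * D ^ (p - 1)`-Lipschitz on `[0, D]`. -/
theorem rpow_le_rpow_add_mul_abs_sub {p D a b : ℝ} (hp : 1 ≤ p) (ha : 0 ≤ a) (haD : a ≤ D)
    (hb : 0 ≤ b) : a ^ p ≤ b ^ p + p * D ^ (p - 1) * |a - b| := by
  have hD : 0 ≤ D := ha.trans haD
  have hpos : 0 ≤ p * D ^ (p - 1) * |a - b| := by positivity
  rcases le_or_gt a b with hab | hab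
  · have := Real.rpow_le_rpow ha hab (by linarith : (0:ℝ) ≤ p)
    linarith
  have ha' : 0 < a := hb.trans_lt hab
  have h1 := one_add_mul_self_le_rpow_one_add (s := b / a - 1)
    (by have : 0 ≤ b / a := by positivity
        linarith) hp
  have h2 : (1 + (b / a - 1)) ^ p = b ^ p / a ^ p := by
    rw [show 1 + (b / a - 1) = b / a by ring, Real.div_rpow hb ha]
  rw [h2, le_div_iff₀ (Real.rpow_pos_of_pos ha' p)] at h1
  have h3 : a ^ p = a ^ (p - 1) * a := by
    rw [Real.rpow_sub_one ha'.ne']; field_simp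
  have h4 : (1 + p * (b / a - 1)) * a ^ p = a ^ p - p * a ^ (p - 1) * (a - b) := by
    rw [h3]; field_simp; ring
  have h5 : a ^ (p - 1) ≤ D ^ (p - 1) := Real.rpow_le_rpow ha haD (by linarith)
  rw [abs_of_pos (by linarith)]
  have h6 : p * a ^ (p - 1) * (a - b) ≤ p * D ^ (p - 1) * (a - b) := by
    gcongr
  linarith

/-- A sub-coupling can be completed to a coupling by adding a product of the missing marginals. -/
theorem exists_coupling_of_subcoupling {α : Type*} [MeasurableSpace α] {μ ν : Measure α}
    [IsProbabilityMeasure μ] [IsProbabilityMeasure ν] {σ : Measure (α × α)}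
    (h₁ : σ.map Prod.fst ≤ μ) (h₂ : σ.map Prod.snd ≤ ν) :
    ∃ ρ : Measure (α × α), (σ + ρ).map Prod.fst = μ ∧ (σ + ρ).map Prod.snd = ν := by
  have hm₁ : σ.map Prod.fst univ = σ univ := by
    rw [Measure.map_apply measurable_fst .univ, preimage_univ]
  have hm₂ : σ.map Prod.snd univ = σ univ := by
    rw [Measure.map_apply measurable_snd .univ, preimage_univ]
  have hσ1 : σ univ ≤ 1 := by
    rw [← hm₁, ← measure_univ (μ := μ)]; exact h₁ _
  have : IsFiniteMeasure σ := ⟨hσ1.trans_lt ENNReal.one_lt_top⟩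
  set μ₀ := μ - σ.map Prod.fst with hμ₀
  set ν₀ := ν - σ.map Prod.snd with hν₀
  have e₁ : σ.map Prod.fst + μ₀ = μ := by
    rw [add_comm]; exact Measure.sub_add_cancel_of_le h₁
  have e₂ : σ.map Prod.snd + ν₀ = ν := by
    rw [add_comm]; exact Measure.sub_add_cancel_of_le h₂
  have u₁ : μ₀ univ = 1 - σ univ := by
    rw [hμ₀, Measure.sub_apply .univ h₁, hm₁, measure_univ]
  have u₂ : ν₀ univ = 1 - σ univ := by
    rw [hν₀, Measure.sub_apply .univ h₂, hm₂, measure_univ]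
  have : IsFiniteMeasure μ₀ := ⟨by rw [u₁]; exact tsub_le_self.trans_lt ENNReal.one_lt_top⟩
  have : IsFiniteMeasure ν₀ := ⟨by rw [u₂]; exact tsub_le_self.trans_lt ENNReal.one_lt_top⟩
  rcases eq_or_ne (1 - σ univ) 0 with h0 | h0
  · refine ⟨0, ?_, ?_⟩
    · rw [add_zero]; conv_rhs => rw [← e₁]
      rw [Measure.measure_univ_eq_zero.1 (u₁.trans h0), add_zero]
    · rw [add_zero]; conv_rhs => rw [← e₂]
      rw [Measure.measure_univ_eq_zero.1 (u₂.trans h0), add_zero]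
  · have ht : 1 - σ univ ≠ ∞ := (tsub_le_self.trans_lt ENNReal.one_lt_top).ne
    refine ⟨(1 - σ univ)⁻¹ • μ₀.prod ν₀, ?_, ?_⟩
    · rw [Measure.map_add _ _ measurable_fst, Measure.map_smul, Measure.map_fst_prod, u₂,
        smul_smul, ENNReal.inv_mul_cancel h0 ht, one_smul, e₁]
    · rw [Measure.map_add _ _ measurable_snd, Measure.map_smul, Measure.map_snd_prod, u₁,
        smul_smul, ENNReal.inv_mul_cancel h0 ht, one_smul, e₂]

theorem ENNReal.inv_max_mul_le_one (a b : ℝ≥0∞) : (max a b)⁻¹ * b ≤ 1 :=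
  (mul_le_mul_right (le_max_right a b) _).trans (ENNReal.inv_mul_le_one _)

theorem ENNReal.le_mul_inv_max_add_tsub {a b : ℝ≥0∞} (ha : a ≠ ∞) (hb : b ≠ ∞) :
    a ≤ a * ((max a b)⁻¹ * b) + (a - b) := by
  rcases le_total a b with h | h
  · rcases eq_or_ne b 0 with rfl | h0
    · simp [le_antisymm h bot_le]
    · rw [max_eq_right h, ENNReal.inv_mul_cancel h0 hb, mul_one]; exact le_self_add
  · rcases eq_or_ne a 0 with rfl | h0
    · simp
    · rw [max_eq_left h, ← mul_assoc, ENNReal.mul_inv_cancel h0 ha, one_mul]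
      exact le_add_tsub

section Transfer

variable {α ι : Type*} [MeasurableSpace α] [Fintype ι] [MeasurableSpace ι]
  [MeasurableSingletonClass ι] {f : α → ι}

theorem sum_measure_inter_fiber (hf : Measurable f) (m : Measure α) (s : Set α) :
    ∑ i, m (f ⁻¹' {i} ∩ s) = m s := by
  have := sum_measure_preimage_singleton (μ := m.restrict s) Finset.univ (f := f)
    fun i _ => hf (measurableSet_singleton i)
  simpa [Measure.restrict_apply (hf (measurableSet_singleton _))] using this

theorem sum_restrict_fiber (hf : Measurable f) (m : Measure α) :
    ∑ i, m.restrict (f ⁻¹' {i}) = m := by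
  ext s hs
  rw [Measure.coe_finsetSum, Finset.sum_apply, ← sum_measure_inter_fiber hf m s]
  exact Finset.sum_congr rfl fun i _ => by rw [Measure.restrict_apply hs, inter_comm]

/-- Transfer of a coupling of `(μ, ν)` to a coupling of `(μ', ν')`: if the cost oscillates by at
most `η` on the cells of a finite partition, the cost increases by at most `η` plus the
discrepancies of the cell masses. -/
theorem exists_coupling_transfer (hf : Measurable f) {A : Set α}
    {μ ν μ' ν' : Measure α} [IsProbabilityMeasure μ] [IsProbabilityMeasure ν]
    [IsProbabilityMeasure μ'] [IsProbabilityMeasure ν']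
    (hμ : ∀ᵐ x ∂μ, x ∈ A) (hν : ∀ᵐ x ∂ν, x ∈ A) (hμ' : ∀ᵐ x ∂μ', x ∈ A) (hν' : ∀ᵐ x ∂ν', x ∈ A)
    {π : Measure (α × α)} (hπ₁ : π.map Prod.fst = μ) (hπ₂ : π.map Prod.snd = ν)
    {c : α × α → ℝ≥0∞} {η M : ℝ≥0∞}
    (hη : ∀ x ∈ A, ∀ y ∈ A, ∀ x' ∈ A, ∀ y' ∈ A, f x = f x' → f y = f y' →
      c (x', y') ≤ c (x, y) + η)
    (hM : ∀ x ∈ A, ∀ y ∈ A, c (x, y) ≤ M) :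
    ∃ γ : Measure (α × α), γ.map Prod.fst = μ' ∧ γ.map Prod.snd = ν' ∧
      ∫⁻ z, c z ∂γ ≤ ∫⁻ z, c z ∂π + η + M * (∑ i, (μ (f ⁻¹' {i}) - μ' (f ⁻¹' {i})) +
        ∑ i, (ν (f ⁻¹' {i}) - ν' (f ⁻¹' {i}))) := by
  have mf : ∀ i, MeasurableSet (f ⁻¹' {i}) := fun i => hf (measurableSet_singleton i)
  have hπu : π univ = 1 := by
    rw [← measure_univ (μ := μ), ← hπ₁, Measure.map_apply measurable_fst .univ, preimage_univ]
  have : IsProbabilityMeasure π := ⟨hπu⟩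
  let F : α × α → ι × ι := fun z => (f z.1, f z.2)
  have hF : Measurable F := by fun_prop
  have hFi : ∀ k : ι × ι, F ⁻¹' {k} = (f ⁻¹' {k.1}) ×ˢ (f ⁻¹' {k.2}) := fun k => by
    ext z; simp [F, Prod.ext_iff]
  have s₁ : ∀ i, ∑ j, π ((f ⁻¹' {i}) ×ˢ (f ⁻¹' {j})) = μ (f ⁻¹' {i}) := fun i => by
    rw [← hπ₁, Measure.map_apply measurable_fst (mf i),
      ← sum_measure_inter_fiber (hf.comp measurable_snd) π (Prod.fst ⁻¹' (f ⁻¹' {i}))]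
    refine Finset.sum_congr rfl fun j _ => ?_
    congr 1; ext z; simp [and_comm]
  have s₂ : ∀ j, ∑ i, π ((f ⁻¹' {i}) ×ˢ (f ⁻¹' {j})) = ν (f ⁻¹' {j}) := fun j => by
    rw [← hπ₂, Measure.map_apply measurable_snd (mf j),
      ← sum_measure_inter_fiber (hf.comp measurable_fst) π (Prod.snd ⁻¹' (f ⁻¹' {j}))]
    refine Finset.sum_congr rfl fun i _ => ?_
    congr 1
  let u : ι → ℝ≥0∞ := fun i => (max (μ (f ⁻¹' {i})) (μ' (f ⁻¹' {i})))⁻¹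
  let v : ι → ℝ≥0∞ := fun j => (max (ν (f ⁻¹' {j})) (ν' (f ⁻¹' {j})))⁻¹
  have hu : ∀ i, u i * μ' (f ⁻¹' {i}) ≤ 1 := fun i => ENNReal.inv_max_mul_le_one _ _
  have hv : ∀ i, v i * ν' (f ⁻¹' {i}) ≤ 1 := fun i => ENNReal.inv_max_mul_le_one _ _
  have hua : ∀ i, μ (f ⁻¹' {i}) * u i ≤ 1 := fun i => by
    rw [mul_comm]; simp only [u]; rw [max_comm]; exact ENNReal.inv_max_mul_le_one _ _
  have hva : ∀ i, ν (f ⁻¹' {i}) * v i ≤ 1 := fun i => by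
    rw [mul_comm]; simp only [v]; rw [max_comm]; exact ENNReal.inv_max_mul_le_one _ _
  let w : ι × ι → ℝ≥0∞ := fun k => π ((f ⁻¹' {k.1}) ×ˢ (f ⁻¹' {k.2})) * (u k.1 * v k.2)
  let σ : Measure (α × α) :=
    ∑ k, w k • (μ'.restrict (f ⁻¹' {k.1})).prod (ν'.restrict (f ⁻¹' {k.2}))
  have hσ : ∀ s t : Set α, MeasurableSet s → MeasurableSet t →
      σ (s ×ˢ t) = ∑ i, ∑ j, w (i, j) * (μ' (f ⁻¹' {i} ∩ s) * ν' (f ⁻¹' {j} ∩ t)) := by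
    intro s t hs ht
    simp only [σ, Measure.coe_finsetSum, Finset.sum_apply, Measure.smul_apply, smul_eq_mul,
      Measure.prod_prod, Measure.restrict_apply hs, Measure.restrict_apply ht]
    rw [Fintype.sum_prod_type]
    simp only [inter_comm]
  have hσ₁ : σ.map Prod.fst ≤ μ' := by
    refine Measure.le_iff.2 fun s hs => ?_
    rw [Measure.map_apply measurable_fst hs, ← prod_univ, hσ s univ hs .univ,
      ← sum_measure_inter_fiber hf μ' s]
    refine Finset.sum_le_sum fun i _ => ?_
    calc ∑ j, w (i, j) * (μ' (f ⁻¹' {i} ∩ s) * ν' (f ⁻¹' {j} ∩ univ))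
        = ∑ j, π ((f ⁻¹' {i}) ×ˢ (f ⁻¹' {j})) * u i * (v j * ν' (f ⁻¹' {j})) *
            μ' (f ⁻¹' {i} ∩ s) := by
          refine Finset.sum_congr rfl fun j _ => ?_
          simp only [w, inter_univ]; ring
      _ ≤ ∑ j, π ((f ⁻¹' {i}) ×ˢ (f ⁻¹' {j})) * u i * 1 * μ' (f ⁻¹' {i} ∩ s) := by
          gcongr with j; exact hv j
      _ = μ (f ⁻¹' {i}) * u i * μ' (f ⁻¹' {i} ∩ s) := by
          simp only [mul_one]; rw [← Finset.sum_mul, ← Finset.sum_mul, s₁]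
      _ ≤ 1 * μ' (f ⁻¹' {i} ∩ s) := by gcongr; exact hua i
      _ = _ := one_mul _
  have hσ₂ : σ.map Prod.snd ≤ ν' := by
    refine Measure.le_iff.2 fun s hs => ?_
    rw [Measure.map_apply measurable_snd hs, ← univ_prod, hσ univ s .univ hs,
      ← sum_measure_inter_fiber hf ν' s, Finset.sum_comm]
    refine Finset.sum_le_sum fun j _ => ?_
    calc ∑ i, w (i, j) * (μ' (f ⁻¹' {i} ∩ univ) * ν' (f ⁻¹' {j} ∩ s))
        = ∑ i, π ((f ⁻¹' {i}) ×ˢ (f ⁻¹' {j})) * v j * (u i * μ' (f ⁻¹' {i})) *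
            ν' (f ⁻¹' {j} ∩ s) := by
          refine Finset.sum_congr rfl fun j _ => ?_
          simp only [w, inter_univ]; ring
      _ ≤ ∑ i, π ((f ⁻¹' {i}) ×ˢ (f ⁻¹' {j})) * v j * 1 * ν' (f ⁻¹' {j} ∩ s) := by
          gcongr with i; exact hu i
      _ = ν (f ⁻¹' {j}) * v j * ν' (f ⁻¹' {j} ∩ s) := by
          simp only [mul_one]; rw [← Finset.sum_mul, ← Finset.sum_mul, s₂]
      _ ≤ 1 * ν' (f ⁻¹' {j} ∩ s) := by gcongr; exact hva j
      _ = _ := one_mul _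
  obtain ⟨ρ, hρ₁, hρ₂⟩ := exists_coupling_of_subcoupling hσ₁ hσ₂
  set T := ∑ i, (μ (f ⁻¹' {i}) - μ' (f ⁻¹' {i})) + ∑ i, (ν (f ⁻¹' {i}) - ν' (f ⁻¹' {i})) with hT
  have hmass : 1 ≤ σ univ + T := by
    have key : ∀ i j, π ((f ⁻¹' {i}) ×ˢ (f ⁻¹' {j})) ≤
        w (i, j) * (μ' (f ⁻¹' {i}) * ν' (f ⁻¹' {j})) +
        (π ((f ⁻¹' {i}) ×ˢ (f ⁻¹' {j})) * (1 - u i * μ' (f ⁻¹' {i})) +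
         π ((f ⁻¹' {i}) ×ˢ (f ⁻¹' {j})) * (1 - v j * ν' (f ⁻¹' {j}))) := by
      intro i j
      set a := u i * μ' (f ⁻¹' {i})
      set b := v j * ν' (f ⁻¹' {j})
      have e : w (i, j) * (μ' (f ⁻¹' {i}) * ν' (f ⁻¹' {j})) =
          π ((f ⁻¹' {i}) ×ˢ (f ⁻¹' {j})) * (a * b) := by simp only [w, a, b]; ring
      rw [e, ← mul_add, ← mul_add]
      conv_lhs => rw [← mul_one (π _)]
      gcongr
      calc (1 : ℝ≥0∞) ≤ a + (1 - a) := le_add_tsub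
        _ ≤ a * (b + (1 - b)) + (1 - a) := by
            gcongr; conv_lhs => rw [← mul_one a]
            gcongr; exact le_add_tsub
        _ ≤ a * b + (1 - a + (1 - b)) := by
            rw [mul_add, add_assoc, add_comm (a * (1 - b))]
            gcongr; exact mul_le_of_le_one_left' (hu i)
    have h1 : ∀ a b c : ℝ≥0∞, a ≠ ∞ → b ≠ ∞ → (c = (max a b)⁻¹) → a * (1 - c * b) ≤ a - b := by
      intro a b c ha hb hc
      rw [hc, ENNReal.mul_sub (fun _ _ => ha), mul_one]
      exact tsub_le_iff_left.2 (ENNReal.le_mul_inv_max_add_tsub ha hb)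
    calc (1 : ℝ≥0∞) = ∑ i, ∑ j, π ((f ⁻¹' {i}) ×ˢ (f ⁻¹' {j})) := by
          rw [Finset.sum_congr rfl fun i _ => s₁ i]
          have := sum_measure_inter_fiber hf μ univ
          simpa using this.symm
      _ ≤ _ := Finset.sum_le_sum fun i _ => Finset.sum_le_sum fun j _ => key i j
      _ ≤ σ univ + T := by
          simp only [Finset.sum_add_distrib]
          have e1 : σ univ = ∑ i, ∑ j, w (i, j) * (μ' (f ⁻¹' {i}) * ν' (f ⁻¹' {j})) := by
            rw [← univ_prod_univ, hσ _ _ .univ .univ]; simp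
          rw [e1, hT]
          refine add_le_add le_rfl (add_le_add ?_ ?_)
          · simp_rw [← Finset.sum_mul, s₁]
            exact Finset.sum_le_sum fun i _ => h1 _ _ _ (measure_ne_top _ _) (measure_ne_top _ _) rfl
          · rw [Finset.sum_comm]
            simp_rw [← Finset.sum_mul, s₂]
            exact Finset.sum_le_sum fun i _ => h1 _ _ _ (measure_ne_top _ _) (measure_ne_top _ _) rfl
  have hρu : ρ univ ≤ T := by
    have h : (σ + ρ) univ = 1 := by
      rw [← measure_univ (μ := μ'), ← hρ₁, Measure.map_apply measurable_fst .univ, preimage_univ]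
    rw [Measure.add_apply] at h
    have hσt : σ univ ≠ ∞ := ne_top_of_le_ne_top ENNReal.one_ne_top (h ▸ le_self_add)
    rw [← h] at hmass
    exact (ENNReal.add_le_add_iff_left hσt).1 hmass
  have hae : ∀ᵐ z ∂(σ + ρ), z.1 ∈ A ∧ z.2 ∈ A := by
    have a1 := ae_of_ae_map (f := Prod.fst) (μ := σ + ρ) measurable_fst.aemeasurable
      (by rw [hρ₁]; exact hμ')
    have a2 := ae_of_ae_map (f := Prod.snd) (μ := σ + ρ) measurable_snd.aemeasurable
      (by rw [hρ₂]; exact hν')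
    exact a1.and a2
  have haeπ : ∀ᵐ z ∂π, z.1 ∈ A ∧ z.2 ∈ A := by
    have a1 := ae_of_ae_map (f := Prod.fst) (μ := π) measurable_fst.aemeasurable
      (by rw [hπ₁]; exact hμ)
    have a2 := ae_of_ae_map (f := Prod.snd) (μ := π) measurable_snd.aemeasurable
      (by rw [hπ₂]; exact hν)
    exact a1.and a2
  refine ⟨σ + ρ, hρ₁, hρ₂, ?_⟩
  rw [lintegral_add_measure]
  refine add_le_add ?_ ?_
  · let m : ι × ι → ℝ≥0∞ := fun k =>
      ⨅ z : {z : α × α // (z.1 ∈ A ∧ z.2 ∈ A) ∧ F z = k}, (c z.1 + η)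
    have hup : ∀ k, ∫⁻ z, c z ∂(w k • (μ'.restrict (f ⁻¹' {k.1})).prod
        (ν'.restrict (f ⁻¹' {k.2}))) ≤ m k * π (F ⁻¹' {k}) := by
      intro k
      have b1 : ∀ᵐ x ∂(μ'.restrict (f ⁻¹' {k.1})), x ∈ A ∧ f x = k.1 :=
        (ae_restrict_of_ae hμ').and (ae_restrict_mem (mf _))
      have b2 : ∀ᵐ x ∂(ν'.restrict (f ⁻¹' {k.2})), x ∈ A ∧ f x = k.2 :=
        (ae_restrict_of_ae hν').and (ae_restrict_mem (mf _))
      have b3 : ∀ᵐ z ∂((μ'.restrict (f ⁻¹' {k.1})).prod (ν'.restrict (f ⁻¹' {k.2}))),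
          c z ≤ m k := by
        filter_upwards [Measure.quasiMeasurePreserving_fst.ae b1,
          Measure.quasiMeasurePreserving_snd.ae b2] with z h1 h2
        refine le_iInf fun z' => ?_
        obtain ⟨⟨x, y⟩, ⟨hx, hy⟩, hk⟩ := z'
        refine hη x hx y hy z.1 h1.1 z.2 h2.1 ?_ ?_
        · rw [h1.2, ← hk]
        · rw [h2.2, ← hk]
      rw [lintegral_smul_measure, smul_eq_mul]
      calc w k * ∫⁻ z, c z ∂((μ'.restrict (f ⁻¹' {k.1})).prod (ν'.restrict (f ⁻¹' {k.2})))
          ≤ w k * ∫⁻ _, m k ∂((μ'.restrict (f ⁻¹' {k.1})).prod (ν'.restrict (f ⁻¹' {k.2}))) := by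
            gcongr 1; exact lintegral_mono_ae b3
        _ = m k * (π (F ⁻¹' {k}) * (u k.1 * μ' (f ⁻¹' {k.1})) * (v k.2 * ν' (f ⁻¹' {k.2}))) := by
            rw [lintegral_const, ← univ_prod_univ, Measure.prod_prod, Measure.restrict_apply_univ,
              Measure.restrict_apply_univ, hFi]
            simp only [w]; ring
        _ ≤ m k * (π (F ⁻¹' {k}) * 1 * 1) := by
            gcongr
            · exact hu _
            · exact hv _
        _ = _ := by rw [mul_one, mul_one]
    have hlo : ∀ k, m k * π (F ⁻¹' {k}) ≤ ∫⁻ z, (c z + η) ∂(π.restrict (F ⁻¹' {k})) := by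
      intro k
      rw [← Measure.restrict_apply_univ (F ⁻¹' {k}), ← lintegral_const]
      refine lintegral_mono_ae ?_
      filter_upwards [ae_restrict_of_ae haeπ, ae_restrict_mem (hF (measurableSet_singleton k))]
        with z h1 h2
      exact iInf_le (fun z : {z : α × α // (z.1 ∈ A ∧ z.2 ∈ A) ∧ F z = k} => c z.1 + η)
        ⟨z, h1, h2⟩
    calc ∫⁻ z, c z ∂σ = ∑ k, ∫⁻ z, c z ∂(w k • (μ'.restrict (f ⁻¹' {k.1})).prod
        (ν'.restrict (f ⁻¹' {k.2}))) := by rw [lintegral_finsetSum_measure]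
      _ ≤ ∑ k, ∫⁻ z, (c z + η) ∂(π.restrict (F ⁻¹' {k})) :=
        Finset.sum_le_sum fun k _ => (hup k).trans (hlo k)
      _ = ∫⁻ z, (c z + η) ∂π := by
        rw [← lintegral_finsetSum_measure, sum_restrict_fiber hF]
      _ = ∫⁻ z, c z ∂π + η := by
        rw [lintegral_add_right _ measurable_const, lintegral_const, hπu, mul_one]
  · calc ∫⁻ z, c z ∂ρ ≤ ∫⁻ _, M ∂ρ := by
          refine lintegral_mono_ae ?_
          have : ρ ≤ σ + ρ := Measure.le_add_left le_rfl
          filter_upwards [ae_mono this hae] with z hz using hM _ hz.1 _ hz.2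
      _ = M * ρ univ := lintegral_const _
      _ ≤ M * T := by gcongr

end Transfer

section Empirical

variable {d n : ℕ}

theorem isProbabilityMeasure_empMeasure (hn : n ≠ 0) (xs : Fin n → Rd d) :
    IsProbabilityMeasure (empMeasure xs) := by
  constructor
  simp only [empMeasure, Measure.smul_apply, Measure.coe_finsetSum, Finset.sum_apply,
    measure_univ, Finset.sum_const, Finset.card_univ, Fintype.card_fin, smul_eq_mul, nsmul_eq_mul,
    mul_one]
  exact ENNReal.inv_mul_cancel (by simpa using hn) (ENNReal.natCast_ne_top n)

theorem ae_empMeasure {xs : Fin n → Rd d} {P : Rd d → Prop} (h : ∀ i, P (xs i)) :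
    ∀ᵐ x ∂(empMeasure xs), P x := by
  refine Measure.ae_smul_measure ?_ _
  rw [← Measure.sum_fintype, Measure.ae_sum_iff]
  exact fun i => by rw [ae_dirac_eq]; exact h i

theorem integrable_empMeasure (hn : n ≠ 0) (xs : Fin n → Rd d) (f : Rd d → ℝ) :
    Integrable f (empMeasure xs) := by
  refine Integrable.smul_measure ?_ (by simpa using hn)
  exact integrable_finsetSum_measure.2 fun i _ => integrable_dirac (by simp)

theorem integral_empMeasure (xs : Fin n → Rd d) (f : Rd d → ℝ) :
    ∫ x, f x ∂(empMeasure xs) = (n : ℝ)⁻¹ * ∑ i, f (xs i) := by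
  rw [empMeasure, integral_smul_measure, integral_finsetSum_measure
    fun i _ => integrable_dirac (by simp)]
  simp

theorem lintegral_empMeasure (xs : Fin n → Rd d) (f : Rd d → ℝ≥0∞) :
    ∫⁻ x, f x ∂(empMeasure xs) = (n : ℝ≥0∞)⁻¹ * ∑ i, f (xs i) := by
  rw [empMeasure, lintegral_smul_measure, lintegral_finsetSum_measure]
  simp

theorem IsCoupling.le_smul_prod_empMeasure (hn : n ≠ 0) {μ : Measure (Rd d)}
    [IsProbabilityMeasure μ] {ys : Fin n → Rd d} {π : Measure (Rd d × Rd d)}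
    (h : IsCoupling π μ (empMeasure ys)) : π ≤ (n : ℝ≥0∞) • μ.prod (empMeasure ys) := by
  have := isProbabilityMeasure_empMeasure hn ys
  refine Measure.le_iff.2 fun s hs => ?_
  have hsnd : ∀ᵐ z ∂π, ∃ j, z.2 = ys j := by
    refine ae_of_ae_map (p := fun y => ∃ j, y = ys j) measurable_snd.aemeasurable ?_
    rw [h.2]
    exact ae_empMeasure fun j => ⟨j, rfl⟩
  have hs' : π s ≤ π (⋃ j, Prod.fst ⁻¹' ((fun x => (x, ys j)) ⁻¹' s)) := by
    refine measure_mono_ae ?_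
    filter_upwards [hsnd] with z ⟨j, hj⟩ hz
    refine mem_iUnion.2 ⟨j, ?_⟩
    change (z.1, ys j) ∈ s
    rw [← hj]; exact hz
  calc π s ≤ ∑ j, π (Prod.fst ⁻¹' ((fun x => (x, ys j)) ⁻¹' s)) :=
        hs'.trans (measure_iUnion_fintype_le _ _)
    _ = ∑ j, μ ((fun x => (x, ys j)) ⁻¹' s) := by
        refine Finset.sum_congr rfl fun j _ => ?_
        rw [← h.1, Measure.map_apply measurable_fst (measurable_prodMk_right hs)]
    _ = _ := by
        rw [Measure.smul_apply, Measure.prod_apply_symm hs, lintegral_empMeasure, smul_eq_mul,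
          ← mul_assoc, ENNReal.mul_inv_cancel (by simpa using hn) (ENNReal.natCast_ne_top n),
          one_mul]

theorem IsCoupling.isProbabilityMeasure {μ ν : Measure (Rd d)} [IsProbabilityMeasure μ]
    {π : Measure (Rd d × Rd d)} (h : IsCoupling π μ ν) : IsProbabilityMeasure π :=
  ⟨by rw [← measure_univ (μ := μ), ← h.1, Measure.map_apply measurable_fst .univ,
    preimage_univ]⟩

theorem IsCoupling.ae_mem {μ ν : Measure (Rd d)} {A : Set (Rd d)} (hμ : ∀ᵐ x ∂μ, x ∈ A)
    (hν : ∀ᵐ x ∂ν, x ∈ A) {π : Measure (Rd d × Rd d)} (h : IsCoupling π μ ν) :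
    ∀ᵐ z ∂π, z.1 ∈ A ∧ z.2 ∈ A :=
  (ae_of_ae_map measurable_fst.aemeasurable (by rw [h.1]; exact hμ)).and
    (ae_of_ae_map measurable_snd.aemeasurable (by rw [h.2]; exact hν))

theorem IsCoupling.absolutelyContinuous_prod_empMeasure (hn : n ≠ 0) {μ : Measure (Rd d)}
    [IsProbabilityMeasure μ] {ys : Fin n → Rd d} {π : Measure (Rd d × Rd d)}
    (h : IsCoupling π μ (empMeasure ys)) : π ≪ μ.prod (empMeasure ys) :=
  (Measure.absolutelyContinuous_of_le (h.le_smul_prod_empMeasure hn)).trans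
    Measure.smul_absolutelyContinuous

theorem klDivR_nonneg {α : Type*} [MeasurableSpace α] {π σ : Measure α} [IsProbabilityMeasure π]
    [IsProbabilityMeasure σ] (h : π ≪ σ) : 0 ≤ klDivR π σ := by
  have := InformationTheory.toReal_klDiv_of_measure_eq h (by simp)
  rw [klDivR]
  exact this ▸ ENNReal.toReal_nonneg

theorem klDivR_le_log_of_le_smul {α : Type*} [MeasurableSpace α] {π σ : Measure α}
    [IsProbabilityMeasure π] [IsProbabilityMeasure σ] (h : π ≤ (n : ℝ≥0∞) • σ) : klDivR π σ ≤ Real.log n := by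
  have hac : π ≪ σ := (Measure.absolutelyContinuous_of_le h).trans
    Measure.smul_absolutelyContinuous
  have hlog : 0 ≤ Real.log n := Real.log_natCast_nonneg n
  have hr : π.rnDeriv σ ≤ᵐ[σ] fun _ => (n : ℝ≥0∞) := by
    refine ae_le_of_forall_setLIntegral_le_of_sigmaFinite (Measure.measurable_rnDeriv _ _)
      fun s hs _ => ?_
    calc ∫⁻ x in s, π.rnDeriv σ x ∂σ ≤ π s := Measure.setLIntegral_rnDeriv_le s
      _ ≤ (n : ℝ≥0∞) * σ s := h s
      _ = _ := by rw [setLIntegral_const]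
  rw [klDivR]
  by_cases hi : Integrable (fun z => Real.log ((π.rnDeriv σ) z).toReal) π
  swap
  · rw [integral_undef hi]; exact hlog
  calc ∫ z, Real.log ((π.rnDeriv σ) z).toReal ∂π ≤ ∫ _, Real.log n ∂π := by
        refine integral_mono_ae hi (integrable_const _) ?_
        filter_upwards [hac.ae_le hr] with z hz
        have h1 : ((π.rnDeriv σ) z).toReal ≤ n := by
          simpa using ENNReal.toReal_mono (ENNReal.natCast_ne_top n) hz
        rcases eq_or_lt_of_le (ENNReal.toReal_nonneg (a := (π.rnDeriv σ) z)) with h0 | h0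
        · rw [← h0, Real.log_zero]; exact hlog
        · exact Real.log_le_log h0 h1
    _ = Real.log n := by simp

end Empirical

section Cube

variable {d : ℕ}

theorem norm_le_sqrt_mul {x : Rd d} {r : ℝ} (hr : 0 ≤ r) (h : ∀ i, |x i| ≤ r) :
    ‖x‖ ≤ √d * r := by
  rw [EuclideanSpace.norm_eq]
  calc √(∑ i, ‖x i‖ ^ 2) ≤ √(∑ _i : Fin d, r ^ 2) := by
        gcongr with i; exact h i
    _ = √d * r := by
        rw [Finset.sum_const, Finset.card_univ, Fintype.card_fin, nsmul_eq_mul,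
          Real.sqrt_mul (Nat.cast_nonneg d), Real.sqrt_sq hr]

theorem norm_sub_le_of_mem_cube01 {x y : Rd d} (hx : x ∈ cube01 d) (hy : y ∈ cube01 d) :
    ‖x - y‖ ≤ √d := by
  have := norm_le_sqrt_mul (x := x - y) zero_le_one fun i => by
    have h1 := hx i
    have h2 := hy i
    rw [PiLp.sub_apply, abs_le]
    constructor <;> linarith [h1.1, h1.2, h2.1, h2.2]
  simpa using this

theorem measurableSet_cube01 : MeasurableSet (cube01 d) := by
  have : cube01 d = ⋂ i, (fun x : Rd d => x i) ⁻¹' Icc (0 : ℝ) 1 := by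
    ext; simp [cube01]
  rw [this]
  exact MeasurableSet.iInter fun i => (by fun_prop : Measurable fun x : Rd d => x i) measurableSet_Icc

/-- Lipschitz constant of `‖x - y‖ ^ p` in each variable on the unit cube. -/
def costLip (d : ℕ) (p : ℝ) : ℝ := p * (√d) ^ (p - 1)

theorem cost_le_add {p : ℝ} (hp : 1 ≤ p) {x y x' y' : Rd d} (hx : x ∈ cube01 d)
    (hy : y ∈ cube01 d) :
    ‖x - y‖ ^ p ≤ ‖x' - y'‖ ^ p + costLip d p * (‖x - x'‖ + ‖y - y'‖) := by
  have h := rpow_le_rpow_add_mul_abs_sub hp (norm_nonneg (x - y))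
    (norm_sub_le_of_mem_cube01 hx hy) (norm_nonneg (x' - y'))
  refine h.trans ?_
  have h2 : |‖x - y‖ - ‖x' - y'‖| ≤ ‖x - x'‖ + ‖y - y'‖ := by
    refine (abs_norm_sub_norm_le _ _).trans ?_
    rw [show x - y - (x' - y') = (x - x') - (y - y') by abel]
    exact norm_sub_le _ _
  rw [costLip]
  gcongr

theorem cost_le {p : ℝ} (hp : 0 ≤ p) {x y : Rd d} (hx : x ∈ cube01 d)
    (hy : y ∈ cube01 d) : ‖x - y‖ ^ p ≤ (√d) ^ p :=
  Real.rpow_le_rpow (norm_nonneg _) (norm_sub_le_of_mem_cube01 hx hy) hp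

/-- Total discrepancy of two measures on the fibres of a map to a finite type. -/
def cellDist {α ι : Type*} [MeasurableSpace α] [Fintype ι] (f : α → ι) (μ ν : Measure α) : ℝ :=
  ∑ i, |μ.real (f ⁻¹' {i}) - ν.real (f ⁻¹' {i})|

theorem cellDist_nonneg {α ι : Type*} [MeasurableSpace α] [Fintype ι] (f : α → ι)
    (μ ν : Measure α) : 0 ≤ cellDist f μ ν := Finset.sum_nonneg fun _ _ => abs_nonneg _

theorem sum_tsub_le_ofReal_cellDist {α ι : Type*} [MeasurableSpace α] [Fintype ι] (f : α → ι)
    (μ ν : Measure α) [IsFiniteMeasure μ] [IsFiniteMeasure ν] :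
    ∑ i, (μ (f ⁻¹' {i}) - ν (f ⁻¹' {i})) ≤ ENNReal.ofReal (cellDist f μ ν) := by
  rw [cellDist, ENNReal.ofReal_sum_of_nonneg fun _ _ => abs_nonneg _]
  refine Finset.sum_le_sum fun i _ => ?_
  rw [← ofReal_measureReal (μ := μ), ← ofReal_measureReal (μ := ν),
    ← ENNReal.ofReal_sub _ measureReal_nonneg]
  exact ENNReal.ofReal_le_ofReal (le_abs_self _)

theorem exists_isCoupling_cost_le {ι : Type*} [Fintype ι] [MeasurableSpace ι]
    [MeasurableSingletonClass ι] {f : Rd d → ι} (hf : Measurable f) {δ p : ℝ} (hp : 1 ≤ p)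
    (hδ : ∀ x ∈ cube01 d, ∀ y ∈ cube01 d, f x = f y → ‖x - y‖ ≤ δ)
    {μ ν μ' ν' : Measure (Rd d)} [IsProbabilityMeasure μ] [IsProbabilityMeasure ν]
    [IsProbabilityMeasure μ'] [IsProbabilityMeasure ν']
    (hμ : ∀ᵐ x ∂μ, x ∈ cube01 d) (hν : ∀ᵐ x ∂ν, x ∈ cube01 d)
    (hμ' : ∀ᵐ x ∂μ', x ∈ cube01 d) (hν' : ∀ᵐ x ∂ν', x ∈ cube01 d)
    {π : Measure (Rd d × Rd d)} (hπ : IsCoupling π μ ν) :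
    ∃ γ, IsCoupling γ μ' ν' ∧ ∫ z, ‖z.1 - z.2‖ ^ p ∂γ ≤ ∫ z, ‖z.1 - z.2‖ ^ p ∂π +
      (2 * costLip d p * δ + (√d) ^ p * (cellDist f μ μ' + cellDist f ν ν')) := by
  have hδ0 : 0 ≤ δ := (norm_nonneg _).trans
    (hδ 0 (fun _ => by simp) 0 (fun _ => by simp) rfl)
  have hL : 0 ≤ costLip d p := by unfold costLip; positivity
  obtain ⟨γ, h₁, h₂, h⟩ := exists_coupling_transfer hf hμ hν hμ' hν' hπ.1 hπ.2
    (c := fun z => ENNReal.ofReal (‖z.1 - z.2‖ ^ p))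
    (η := ENNReal.ofReal (2 * costLip d p * δ)) (M := ENNReal.ofReal ((√d) ^ p))
    (fun x hx y hy x' hx' y' hy' e₁ e₂ => by
      rw [← ENNReal.ofReal_add (by positivity) (by positivity)]
      refine ENNReal.ofReal_le_ofReal ((cost_le_add hp hx' hy' (x' := x) (y' := y)).trans ?_)
      have a1 := hδ x' hx' x hx e₁.symm
      have a2 := hδ y' hy' y hy e₂.symm
      have : costLip d p * (‖x' - x‖ + ‖y' - y‖) ≤ costLip d p * (δ + δ) := by gcongr
      dsimp only
      linarith)
    (fun x hx y hy => ENNReal.ofReal_le_ofReal (cost_le (by linarith) hx hy))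
  have hγ : IsCoupling γ μ' ν' := ⟨h₁, h₂⟩
  refine ⟨γ, hγ, ?_⟩
  have := hπ.isProbabilityMeasure
  have hmeas : ∀ m : Measure (Rd d × Rd d),
      AEStronglyMeasurable (fun z : Rd d × Rd d => ‖z.1 - z.2‖ ^ p) m := fun m =>
    (by fun_prop : Measurable fun z : Rd d × Rd d => ‖z.1 - z.2‖ ^ p).aestronglyMeasurable
  have hpi : Integrable (fun z : Rd d × Rd d => ‖z.1 - z.2‖ ^ p) π := by
    refine Integrable.of_bound (hmeas _) ((√d) ^ p) ?_
    filter_upwards [hπ.ae_mem hμ hν] with z hz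
    rw [Real.norm_of_nonneg (by positivity)]
    exact cost_le (by linarith) hz.1 hz.2
  have c1 := cellDist_nonneg f μ μ'
  have c2 := cellDist_nonneg f ν ν'
  have i0 : 0 ≤ ∫ z, ‖z.1 - z.2‖ ^ p ∂π := integral_nonneg fun z => by positivity
  rw [integral_eq_lintegral_of_nonneg_ae (Filter.Eventually.of_forall fun z => by positivity)
    (hmeas _)]
  refine ENNReal.toReal_le_of_le_ofReal (by positivity) (h.trans ?_)
  rw [ENNReal.ofReal_add i0 (by positivity), ENNReal.ofReal_add (by positivity) (by positivity),
    ENNReal.ofReal_mul (p := (√d) ^ p) (by positivity), ENNReal.ofReal_add c1 c2, ← add_assoc]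
  rw [ofReal_integral_eq_lintegral_ofReal hpi (Filter.Eventually.of_forall fun z => by positivity)]
  gcongr
  · exact sum_tsub_le_ofReal_cellDist _ _ _
  · exact sum_tsub_le_ofReal_cellDist _ _ _

end Cube

section Softmax

theorem integral_le_integral_add_of_le_exp_smul {α : Type*} [MeasurableSpace α]
    {P Q : Measure α} [IsProbabilityMeasure P] [IsProbabilityMeasure Q] {t : ℝ} (ht : 0 ≤ t)
    (hPQ : P ≤ ENNReal.ofReal (Real.exp t) • Q) {h : α → ℝ} (hm : Measurable h) {M : ℝ}
    (h0 : ∀ x, 0 ≤ h x) (hM : ∀ᵐ x ∂Q, h x ≤ M) :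
    ∫ x, h x ∂P ≤ ∫ x, h x ∂Q + 2 * t * M := by
  have hMP : ∀ᵐ x ∂P, h x ≤ M :=
    ((Measure.absolutelyContinuous_of_le hPQ).trans Measure.smul_absolutelyContinuous).ae_le hM
  have hM0 : 0 ≤ M := by
    obtain ⟨x, hx⟩ := hM.exists
    exact (h0 x).trans hx
  have iQ : Integrable h Q := Integrable.of_bound hm.aestronglyMeasurable M <| by
    filter_upwards [hM] with x hx
    rwa [Real.norm_of_nonneg (h0 x)]
  have hP1 : ∫ x, h x ∂P ≤ M := by
    calc ∫ x, h x ∂P ≤ ∫ _, M ∂P := by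
          refine integral_mono_of_nonneg (Filter.Eventually.of_forall h0) (integrable_const _) hMP
      _ = M := by simp
  have hQ0 : 0 ≤ ∫ x, h x ∂Q := integral_nonneg h0
  have hQ1 : ∫ x, h x ∂Q ≤ M := by
    calc ∫ x, h x ∂Q ≤ ∫ _, M ∂Q := by
          refine integral_mono_of_nonneg (Filter.Eventually.of_forall h0) (integrable_const _) hM
      _ = M := by simp
  rcases le_or_gt t 1 with h1 | h1
  · have hexp : Real.exp t - 1 ≤ 2 * t := by
      have := Real.abs_exp_sub_one_le (x := t) (by rwa [abs_of_nonneg ht])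
      rw [abs_of_nonneg ht] at this
      exact (le_abs_self _).trans this
    have : ∫ x, h x ∂P ≤ Real.exp t * ∫ x, h x ∂Q := by
      have := integral_mono_measure hPQ (Filter.Eventually.of_forall h0)
        (iQ.smul_measure ENNReal.ofReal_ne_top)
      rwa [integral_smul_measure, ENNReal.toReal_ofReal (Real.exp_pos t).le, smul_eq_mul] at this
    have h3 : (Real.exp t - 1) * ∫ x, h x ∂Q ≤ 2 * t * M := by gcongr
    linarith
  · nlinarith

variable {d n : ℕ} {p τ : ℝ} {ys : Fin n → Rd d} {g : Rd d → ℝ} {κ : Kernel (Rd d) (Rd d)}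

theorem costLip_nonneg (hp : 1 ≤ p) : 0 ≤ costLip d p := by unfold costLip; positivity

/-- The softmax kernel is log-Lipschitz in its first argument. -/
theorem softmax_kernel_le_smul (hn : n ≠ 0) (hp : 1 ≤ p) (hτ : 0 < τ)
    (hys : ∀ j, ys j ∈ cube01 d)
    (hκ : ∀ x, κ x = (empMeasure ys).withDensity (fun y =>
      ENNReal.ofReal (Real.exp ((g y - ‖x - y‖ ^ p) / τ) /
        ∫ y', Real.exp ((g y' - ‖x - y'‖ ^ p) / τ) ∂(empMeasure ys))))
    {x x' : Rd d} (hx : x ∈ cube01 d) (hx' : x' ∈ cube01 d) :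
    κ x ≤ ENNReal.ofReal (Real.exp (2 * costLip d p / τ * ‖x - x'‖)) • κ x' := by
  have := isProbabilityMeasure_empMeasure hn ys
  set t := costLip d p / τ * ‖x - x'‖ with ht
  have hpt : ∀ y ∈ cube01 d, ∀ z ∈ cube01 d, ∀ z' ∈ cube01 d, ‖z - z'‖ = ‖x - x'‖ →
      Real.exp ((g y - ‖z - y‖ ^ p) / τ) ≤
        Real.exp t * Real.exp ((g y - ‖z' - y‖ ^ p) / τ) := by
    intro y hy z hz z' hz' e
    rw [← Real.exp_add, Real.exp_le_exp, ht, ← e]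
    have := cost_le_add hp hz' hy (x' := z) (y' := y)
    rw [sub_self, norm_zero, add_zero, norm_sub_rev z' z] at this
    rw [div_mul_eq_mul_div, ← add_div]
    gcongr
    linarith
  have hZpos : ∀ z, 0 < ∫ y', Real.exp ((g y' - ‖z - y'‖ ^ p) / τ) ∂(empMeasure ys) := by
    intro z
    rw [integral_empMeasure]
    have : Nonempty (Fin n) := ⟨⟨0, Nat.pos_of_ne_zero hn⟩⟩
    have : 0 < ∑ i, Real.exp ((g (ys i) - ‖z - ys i‖ ^ p) / τ) :=
      Finset.sum_pos (fun i _ => Real.exp_pos _) Finset.univ_nonempty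
    positivity
  have hZ : ∫ y', Real.exp ((g y' - ‖x' - y'‖ ^ p) / τ) ∂(empMeasure ys) ≤
      Real.exp t * ∫ y', Real.exp ((g y' - ‖x - y'‖ ^ p) / τ) ∂(empMeasure ys) := by
    rw [← integral_const_mul]
    refine integral_mono_ae (integrable_empMeasure hn _ _) (integrable_empMeasure hn _ _) ?_
    exact ae_empMeasure fun j => hpt _ (hys j) _ hx' _ hx (norm_sub_rev _ _)
  rw [hκ x, hκ x', ← withDensity_smul' _ _ ENNReal.ofReal_ne_top]
  refine withDensity_mono (ae_empMeasure fun j => ?_)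
  rw [Pi.smul_apply, smul_eq_mul, ← ENNReal.ofReal_mul (Real.exp_pos _).le]
  refine ENNReal.ofReal_le_ofReal ?_
  rw [← mul_div_assoc, div_le_div_iff₀ (hZpos x) (hZpos x')]
  have h2 : Real.exp (2 * costLip d p / τ * ‖x - x'‖) = Real.exp t * Real.exp t := by
    rw [← Real.exp_add]; congr 1; rw [ht]; ring
  rw [h2]
  calc _ ≤ (Real.exp t * Real.exp ((g (ys j) - ‖x' - ys j‖ ^ p) / τ)) *
        (Real.exp t * ∫ y', Real.exp ((g y' - ‖x - y'‖ ^ p) / τ) ∂(empMeasure ys)) := by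
        refine mul_le_mul (hpt _ (hys j) _ hx _ hx' rfl) hZ (hZpos x').le (by positivity)
    _ = _ := by ring

theorem softmax_kernel_ae_mem (hys : ∀ j, ys j ∈ cube01 d)
    (hκ : ∀ x, κ x = (empMeasure ys).withDensity (fun y =>
      ENNReal.ofReal (Real.exp ((g y - ‖x - y‖ ^ p) / τ) /
        ∫ y', Real.exp ((g y' - ‖x - y'‖ ^ p) / τ) ∂(empMeasure ys)))) (x : Rd d) :
    ∀ᵐ y ∂(κ x), y ∈ cube01 d := by
  rw [hκ x]
  exact (withDensity_absolutelyContinuous _ _).ae_le (ae_empMeasure hys)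

variable [IsMarkovKernel κ]

theorem kernel_cost_lipschitz (hp : 1 ≤ p) (hτ : 0 < τ)
    (hmem : ∀ x, ∀ᵐ y ∂(κ x), y ∈ cube01 d)
    (hκ : ∀ x ∈ cube01 d, ∀ x' ∈ cube01 d,
      κ x ≤ ENNReal.ofReal (Real.exp (2 * costLip d p / τ * ‖x - x'‖)) • κ x')
    {x x' : Rd d} (hx : x ∈ cube01 d) (hx' : x' ∈ cube01 d) :
    ∫ y, ‖x - y‖ ^ p ∂(κ x) ≤ ∫ y, ‖x' - y‖ ^ p ∂(κ x') +
      (costLip d p + 4 * costLip d p * (√d) ^ p / τ) * ‖x - x'‖ := by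
  have hL := costLip_nonneg (d := d) hp
  have hint : ∀ z ∈ cube01 d, ∀ w, Integrable (fun y => ‖z - y‖ ^ p) (κ w) := by
    intro z hz w
    refine Integrable.of_bound (by fun_prop : Measurable fun y => ‖z - y‖ ^ p).aestronglyMeasurable
      ((√d) ^ p) ?_
    filter_upwards [hmem w] with y hy
    rw [Real.norm_of_nonneg (by positivity)]
    exact cost_le (by linarith) hz hy
  have h1 : ∫ y, ‖x - y‖ ^ p ∂(κ x) ≤ ∫ y, ‖x' - y‖ ^ p ∂(κ x) + costLip d p * ‖x - x'‖ := by
    calc _ ≤ ∫ y, (‖x' - y‖ ^ p + costLip d p * ‖x - x'‖) ∂(κ x) := by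
          refine integral_mono_ae (hint x hx x) ((hint x' hx' x).add (integrable_const _)) ?_
          filter_upwards [hmem x] with y hy
          simpa using cost_le_add hp hx hy (x' := x') (y' := y)
      _ = _ := by rw [integral_add (hint x' hx' x) (integrable_const _)]; simp
  have h2 := integral_le_integral_add_of_le_exp_smul (by positivity) (hκ x hx x' hx')
    (h := fun y => ‖x' - y‖ ^ p) (by fun_prop) (M := (√d) ^ p) (fun y => by positivity)
    (by filter_upwards [hmem x'] with y hy using cost_le (by linarith) hx' hy)
  calc _ ≤ _ := h1
    _ ≤ _ := add_le_add_left h2 _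
    _ = _ := by ring

theorem kernel_integral_lipschitz (hp : 1 ≤ p) (hτ : 0 < τ)
    (hκ : ∀ x ∈ cube01 d, ∀ x' ∈ cube01 d,
      κ x ≤ ENNReal.ofReal (Real.exp (2 * costLip d p / τ * ‖x - x'‖)) • κ x')
    {h : Rd d → ℝ} (hm : Measurable h) (hb : ∀ y, |h y| ≤ 1)
    {x x' : Rd d} (hx : x ∈ cube01 d) (hx' : x' ∈ cube01 d) :
    ∫ y, h y ∂(κ x) ≤ ∫ y, h y ∂(κ x') + 8 * costLip d p / τ * ‖x - x'‖ := by
  have hL := costLip_nonneg (d := d) hp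
  have hint : ∀ w, Integrable h (κ w) := fun w =>
    Integrable.of_bound hm.aestronglyMeasurable 1 (Filter.Eventually.of_forall hb)
  have h2 := integral_le_integral_add_of_le_exp_smul (by positivity) (hκ x hx x' hx')
    (h := fun y => h y + 1) (by fun_prop) (M := 2)
    (fun y => by linarith [(abs_le.1 (hb y)).1])
    (Filter.Eventually.of_forall fun y => by linarith [(abs_le.1 (hb y)).2])
  rw [integral_add (hint _) (integrable_const _), integral_add (hint _) (integrable_const _)] at h2
  simp only [integral_const, probReal_univ, smul_eq_mul, mul_one] at h2
  calc ∫ y, h y ∂(κ x) ≤ ∫ y, h y ∂(κ x') + 2 * (2 * costLip d p / τ * ‖x - x'‖) * 2 := by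
        linarith
    _ = _ := by ring

end Softmax

section Chaining

variable {d : ℕ}

/-- Index of the dyadic cell of side `2⁻ʲ` containing a point of the unit cube. -/
def cellIdx (j : ℕ) (x : Rd d) : Fin d → Fin (2 ^ j + 1) :=
  fun i => Fin.ofNat (2 ^ j + 1) ⌊(2 : ℝ) ^ j * x i⌋₊

theorem measurable_cellIdx (j : ℕ) : Measurable (cellIdx (d := d) j) := by
  refine measurable_pi_iff.2 fun i => ?_
  exact (measurable_from_top (f := fun k : ℕ => Fin.ofNat (2 ^ j + 1) k)).comp
    (Nat.measurable_floor.comp (by fun_prop))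

theorem cellIdx_val {j : ℕ} {x : Rd d} (hx : x ∈ cube01 d) (i : Fin d) :
    (cellIdx j x i : ℕ) = ⌊(2 : ℝ) ^ j * x i⌋₊ := by
  have h : ⌊(2 : ℝ) ^ j * x i⌋₊ ≤ 2 ^ j := by
    refine Nat.floor_le_of_le ?_
    push_cast
    have := (hx i).2
    have h2 : (0 : ℝ) < 2 ^ j := by positivity
    nlinarith
  simp only [cellIdx, Fin.val_ofNat]
  exact Nat.mod_eq_of_lt (by omega)

theorem card_cellIdx_le (j : ℕ) :
    (Fintype.card (Fin d → Fin (2 ^ j + 1)) : ℝ) ≤ 2 ^ d * (2 ^ j) ^ d := by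
  rw [Fintype.card_fun, Fintype.card_fin, Fintype.card_fin, ← mul_pow]
  push_cast
  gcongr
  have : (1 : ℝ) ≤ 2 ^ j := one_le_pow₀ (by norm_num)
  linarith

/-- Lower corner of a dyadic cell. -/
def cellCorner {m : ℕ} (j : ℕ) (k : Fin d → Fin m) : Rd d :=
  WithLp.toLp 2 fun i => ((k i : ℕ) : ℝ) / 2 ^ j

/-- Lower corner of the parent of a dyadic cell. -/
def parentCorner {m : ℕ} (j : ℕ) (k : Fin d → Fin m) : Rd d :=
  WithLp.toLp 2 fun i => (((k i : ℕ) / 2 : ℕ) : ℝ) / 2 ^ j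

theorem cellCorner_mem (j : ℕ) (k : Fin d → Fin (2 ^ j + 1)) : cellCorner j k ∈ cube01 d := by
  intro i
  have h : (k i : ℕ) ≤ 2 ^ j := Nat.lt_succ_iff.1 (k i).2
  have h' : ((k i : ℕ) : ℝ) ≤ 2 ^ j := by exact_mod_cast h
  exact ⟨by simp only [cellCorner]; positivity, div_le_one_of_le₀ h' (by positivity)⟩

theorem parentCorner_mem (j : ℕ) (k : Fin d → Fin (2 ^ (j + 1) + 1)) :
    parentCorner j k ∈ cube01 d := by
  intro i
  have h : (k i : ℕ) / 2 ≤ 2 ^ j := by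
    have h1 := (k i).2
    have h2 : 2 ^ (j + 1) = 2 ^ j * 2 := pow_succ 2 j
    omega
  have h' : (((k i : ℕ) / 2 : ℕ) : ℝ) ≤ 2 ^ j := by exact_mod_cast h
  exact ⟨by simp only [parentCorner]; positivity, div_le_one_of_le₀ h' (by positivity)⟩

theorem norm_sub_cellCorner_le {j : ℕ} {x : Rd d} (hx : x ∈ cube01 d) :
    ‖x - cellCorner j (cellIdx j x)‖ ≤ √d * (2 ^ j)⁻¹ := by
  refine norm_le_sqrt_mul (by positivity) fun i => ?_
  rw [PiLp.sub_apply, cellCorner]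
  simp only [cellIdx_val hx]
  have h2 : (0 : ℝ) < 2 ^ j := by positivity
  have h1 := Nat.floor_le (a := (2 : ℝ) ^ j * x i) (mul_nonneg h2.le (hx i).1)
  have h3 := Nat.lt_floor_add_one ((2 : ℝ) ^ j * x i)
  have e : x i - (⌊(2 : ℝ) ^ j * x i⌋₊ : ℝ) / 2 ^ j =
      ((2 : ℝ) ^ j * x i - ⌊(2 : ℝ) ^ j * x i⌋₊) * (2 ^ j)⁻¹ := by field_simp
  rw [e, abs_mul, abs_of_pos (inv_pos.2 h2), abs_of_nonneg (by linarith)]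
  exact mul_le_of_le_one_left (by positivity) (by linarith)

theorem norm_sub_le_of_cellIdx_eq {j : ℕ} {x y : Rd d} (hx : x ∈ cube01 d) (hy : y ∈ cube01 d)
    (h : cellIdx j x = cellIdx j y) : ‖x - y‖ ≤ 2 * √d * (2 ^ j)⁻¹ := by
  have h1 := norm_sub_cellCorner_le (j := j) hx
  have h2 := norm_sub_cellCorner_le (j := j) hy
  rw [← h, norm_sub_rev] at h2
  have := norm_sub_le_norm_sub_add_norm_sub x (cellCorner j (cellIdx j x)) y
  linarith

theorem parentCorner_cellIdx {j : ℕ} {x : Rd d} (hx : x ∈ cube01 d) :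
    parentCorner j (cellIdx (j + 1) x) = cellCorner j (cellIdx j x) := by
  simp only [parentCorner, cellCorner, cellIdx_val hx]
  congr 1
  funext i
  congr 2
  have := Nat.floor_div_natCast ((2 : ℝ) ^ (j + 1) * x i) 2
  rw [← this]
  congr 1
  push_cast
  rw [pow_succ]; ring

theorem norm_cellCorner_sub_parentCorner_le {m : ℕ} (j : ℕ) (k : Fin d → Fin m) :
    ‖cellCorner (j + 1) k - parentCorner j k‖ ≤ √d * (2 ^ (j + 1))⁻¹ := by
  refine norm_le_sqrt_mul (by positivity) fun i => ?_
  rw [PiLp.sub_apply, cellCorner, parentCorner]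
  simp only
  have h2 : (0 : ℝ) < 2 ^ j := by positivity
  have h : (k i : ℕ) = 2 * ((k i : ℕ) / 2) + (k i : ℕ) % 2 := (Nat.div_add_mod _ _).symm
  have h' : ((k i : ℕ) : ℝ) = 2 * (((k i : ℕ) / 2 : ℕ) : ℝ) + (((k i : ℕ) % 2 : ℕ) : ℝ) := by
    exact_mod_cast h
  have h3 : (((k i : ℕ) % 2 : ℕ) : ℝ) ≤ 1 := by
    have := Nat.mod_lt (k i : ℕ) (by norm_num : 2 > 0)
    exact_mod_cast Nat.lt_succ_iff.1 this
  have e : ((k i : ℕ) : ℝ) / 2 ^ (j + 1) - (((k i : ℕ) / 2 : ℕ) : ℝ) / 2 ^ j =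
      (((k i : ℕ) % 2 : ℕ) : ℝ) * (2 ^ (j + 1))⁻¹ := by
    rw [h', pow_succ]; field_simp; ring
  rw [e, abs_of_nonneg (by positivity)]
  exact mul_le_of_le_one_left (by positivity) h3

theorem integral_comp_eq_sum {α ι : Type*} [MeasurableSpace α] [Fintype ι]
    [MeasurableSpace ι] [MeasurableSingletonClass ι] {f : α → ι} (hf : Measurable f)
    (m : Measure α) [IsFiniteMeasure m] (G : ι → ℝ) :
    ∫ x, G (f x) ∂m = ∑ i, m.real (f ⁻¹' {i}) * G i := by
  rw [← integral_map (f := G) hf.aemeasurable (measurable_of_finite G).aestronglyMeasurable,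
    integral_fintype Integrable.of_finite]
  refine Finset.sum_congr rfl fun i _ => ?_
  rw [map_measureReal_apply hf (measurableSet_singleton i), smul_eq_mul]

theorem integral_comp_sub_le_cellDist {α ι : Type*} [MeasurableSpace α] [Fintype ι]
    [MeasurableSpace ι] [MeasurableSingletonClass ι] {f : α → ι} (hf : Measurable f)
    (m m' : Measure α) [IsFiniteMeasure m] [IsFiniteMeasure m'] {G : ι → ℝ} {B : ℝ}
    (hG : ∀ i, |G i| ≤ B) : ∫ x, G (f x) ∂m ≤ ∫ x, G (f x) ∂m' + B * cellDist f m m' := by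
  rw [integral_comp_eq_sum hf, integral_comp_eq_sum hf, cellDist, Finset.mul_sum, ← Finset.sum_add_distrib]
  refine Finset.sum_le_sum fun i _ => ?_
  have h1 : (m.real (f ⁻¹' {i}) - m'.real (f ⁻¹' {i})) * G i ≤
      B * |m.real (f ⁻¹' {i}) - m'.real (f ⁻¹' {i})| := by
    refine (le_abs_self _).trans ?_
    rw [abs_mul, mul_comm]
    gcongr
    exact hG i
  linarith

/-- Multiscale dyadic bound for the bounded-Lipschitz discrepancy of two measures. -/
def dyadicDist (J : ℕ) (m m' : Measure (Rd d)) : ℝ :=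
  √d * (2 * (2 ^ J)⁻¹ + ∑ j ∈ Finset.range (J + 1), (2 ^ j)⁻¹ * cellDist (cellIdx j) m m')

theorem integral_le_integral_add_dyadicDist (J : ℕ) {m m' : Measure (Rd d)}
    [IsProbabilityMeasure m] [IsProbabilityMeasure m'] (hm : ∀ᵐ x ∂m, x ∈ cube01 d)
    (hm' : ∀ᵐ x ∂m', x ∈ cube01 d) {F : Rd d → ℝ} (hF : Measurable F) {L : ℝ} (hL : 0 ≤ L)
    (hFL : ∀ x ∈ cube01 d, ∀ x' ∈ cube01 d, F x ≤ F x' + L * ‖x - x'‖) :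
    ∫ x, F x ∂m ≤ ∫ x, F x ∂m' + L * dyadicDist J m m' := by
  have habs : ∀ x ∈ cube01 d, ∀ x' ∈ cube01 d, |F x - F x'| ≤ L * ‖x - x'‖ := by
    intro x hx x' hx'
    have h1 := hFL x hx x' hx'
    have h2 := hFL x' hx' x hx
    rw [norm_sub_rev] at h2
    rw [abs_le]; constructor <;> linarith
  have h0mem : (0 : Rd d) ∈ cube01 d := fun i => by simp
  let Φ : (j : ℕ) → Rd d → ℝ := fun j x => F (cellCorner j (cellIdx j x))
  have hΦm : ∀ j, Measurable (Φ j) := fun j =>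
    (measurable_of_finite fun k => F (cellCorner j k)).comp (measurable_cellIdx j)
  have hbound : ∀ x ∈ cube01 d, ‖F x‖ ≤ |F 0| + L * √d := by
    intro x hx
    have h1 := habs x hx 0 h0mem
    have h2 : L * ‖x - 0‖ ≤ L * √d := by gcongr; exact norm_sub_le_of_mem_cube01 hx h0mem
    have h3 := abs_sub_abs_le_abs_sub (F x) (F 0)
    rw [Real.norm_eq_abs]; linarith
  have hΦi : ∀ j (q : Measure (Rd d)) [IsProbabilityMeasure q], Integrable (Φ j) q :=
    fun j q _ => Integrable.of_bound (hΦm j).aestronglyMeasurable (|F 0| + L * √d)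
      (Filter.Eventually.of_forall fun x => hbound _ (cellCorner_mem _ _))
  have hFi : ∀ (q : Measure (Rd d)) [IsProbabilityMeasure q], (∀ᵐ x ∂q, x ∈ cube01 d) →
      Integrable F q := fun q _ hq => Integrable.of_bound hF.aestronglyMeasurable
        (|F 0| + L * √d) (by filter_upwards [hq] with x hx using hbound x hx)
  have hstep : ∀ j, ∫ x, Φ (j + 1) x ∂m - ∫ x, Φ (j + 1) x ∂m' ≤
      ∫ x, Φ j x ∂m - ∫ x, Φ j x ∂m' +
        L * √d * ((2 ^ (j + 1))⁻¹ * cellDist (cellIdx (j + 1)) m m') := by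
    intro j
    let G : (Fin d → Fin (2 ^ (j + 1) + 1)) → ℝ :=
      fun k => F (cellCorner (j + 1) k) - F (parentCorner j k)
    have hG : ∀ k, |G k| ≤ L * (√d * (2 ^ (j + 1))⁻¹) := fun k =>
      (habs _ (cellCorner_mem _ _) _ (parentCorner_mem _ _)).trans
        (mul_le_mul_of_nonneg_left (norm_cellCorner_sub_parentCorner_le j k) hL)
    have h1 := integral_comp_sub_le_cellDist (measurable_cellIdx (j + 1)) m m' hG
    have e : ∀ (q : Measure (Rd d)) [IsProbabilityMeasure q], (∀ᵐ x ∂q, x ∈ cube01 d) →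
        ∫ x, G (cellIdx (j + 1) x) ∂q = ∫ x, Φ (j + 1) x ∂q - ∫ x, Φ j x ∂q := by
      intro q _ hq
      rw [← integral_sub (hΦi _ q) (hΦi _ q)]
      refine integral_congr_ae ?_
      filter_upwards [hq] with x hx
      simp only [G, Φ, parentCorner_cellIdx hx]
    rw [e m hm, e m' hm'] at h1
    linarith
  have hzero : ∫ x, Φ 0 x ∂m - ∫ x, Φ 0 x ∂m' ≤
      L * √d * ((2 ^ 0)⁻¹ * cellDist (cellIdx 0) m m') := by
    have hG : ∀ k : Fin d → Fin (2 ^ 0 + 1), |F (cellCorner 0 k) - F 0| ≤ L * √d := fun k =>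
      (habs _ (cellCorner_mem _ _) _ h0mem).trans
        (mul_le_mul_of_nonneg_left (norm_sub_le_of_mem_cube01 (cellCorner_mem _ _) h0mem) hL)
    have h1 := integral_comp_sub_le_cellDist (measurable_cellIdx 0) m m' hG
    have e : ∀ (q : Measure (Rd d)) [IsProbabilityMeasure q],
        ∫ x, (F (cellCorner 0 (cellIdx 0 x)) - F 0) ∂q = ∫ x, Φ 0 x ∂q - F 0 := by
      intro q _
      rw [integral_sub (hΦi 0 q) (integrable_const _)]; simp [Φ]
    rw [e m, e m'] at h1
    simp only [pow_zero, inv_one, one_mul] at h1 ⊢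
    linarith
  have hall : ∀ J, ∫ x, Φ J x ∂m - ∫ x, Φ J x ∂m' ≤
      L * √d * ∑ j ∈ Finset.range (J + 1), (2 ^ j)⁻¹ * cellDist (cellIdx j) m m' := by
    intro J
    induction J with
    | zero => simpa using hzero
    | succ J ih =>
      rw [Finset.sum_range_succ, mul_add]
      linarith [hstep J]
  have hend : ∀ (q : Measure (Rd d)) [IsProbabilityMeasure q], (∀ᵐ x ∂q, x ∈ cube01 d) →
      |∫ x, F x ∂q - ∫ x, Φ J x ∂q| ≤ L * (√d * (2 ^ J)⁻¹) := by
    intro q _ hq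
    rw [← integral_sub (hFi q hq) (hΦi J q)]
    have := norm_integral_le_of_norm_le_const (μ := q) (f := fun x => F x - Φ J x)
      (C := L * (√d * (2 ^ J)⁻¹)) (by
        filter_upwards [hq] with x hx
        exact (habs x hx _ (cellCorner_mem _ _)).trans
          (mul_le_mul_of_nonneg_left (norm_sub_cellCorner_le hx) hL))
    simpa using this
  have e1 := (abs_le.1 (hend m hm)).2
  have e2 := (abs_le.1 (hend m' hm')).1
  have e3 := hall J
  have e4 : L * dyadicDist J m m' = 2 * (L * (√d * (2 ^ J)⁻¹)) +
      L * √d * ∑ j ∈ Finset.range (J + 1), (2 ^ j)⁻¹ * cellDist (cellIdx j) m m' := by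
    rw [dyadicDist]; ring
  linarith

end Chaining

section KernelCoupling

variable {d : ℕ} {κ : Kernel (Rd d) (Rd d)} [IsMarkovKernel κ] {m : Measure (Rd d)}

theorem kernelCoupling_eq_compProd [SFinite m] : kernelCoupling κ m = m ⊗ₘ κ := by
  rw [Measure.compProd_eq_comp_prod, kernelCoupling]
  congr 1
  funext x
  rw [Kernel.prod_apply, Kernel.id_apply, Measure.dirac_prod]

theorem kpush_eq_snd_compProd [SFinite m] : kpush κ m = (m ⊗ₘ κ).snd :=
  (Measure.snd_compProd m κ).symm

theorem isProbabilityMeasure_kpush [IsProbabilityMeasure m] :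
    IsProbabilityMeasure (kpush κ m) := by
  rw [kpush_eq_snd_compProd]; infer_instance

theorem ae_mem_kpush [SFinite m] {A : Set (Rd d)} (hA : MeasurableSet A)
    (h : ∀ x, ∀ᵐ y ∂(κ x), y ∈ A) : ∀ᵐ y ∂(kpush κ m), y ∈ A := by
  rw [kpush_eq_snd_compProd, Measure.snd]
  refine (ae_map_iff measurable_snd.aemeasurable hA).2 ?_
  exact Measure.ae_compProd_of_ae_ae (measurable_snd hA) (Filter.Eventually.of_forall h)

theorem integral_kpush [IsProbabilityMeasure m] {h : Rd d → ℝ} (hm : Measurable h)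
    (hb : ∀ y, |h y| ≤ 1) : ∫ y, h y ∂(kpush κ m) = ∫ x, ∫ y, h y ∂(κ x) ∂m := by
  rw [kpush_eq_snd_compProd, Measure.snd,
    integral_map measurable_snd.aemeasurable hm.aestronglyMeasurable]
  exact Measure.integral_compProd (Integrable.of_bound (hm.comp measurable_snd).aestronglyMeasurable 1
    (Filter.Eventually.of_forall fun z => hb z.2))

end KernelCoupling

section CellDist

variable {α ι : Type*} [MeasurableSpace α] [Fintype ι]

theorem cellDist_triangle (f : α → ι) (m₁ m₂ m₃ : Measure α) :
    cellDist f m₁ m₃ ≤ cellDist f m₁ m₂ + cellDist f m₂ m₃ := by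
  rw [cellDist, cellDist, cellDist, ← Finset.sum_add_distrib]
  exact Finset.sum_le_sum fun i _ => abs_sub_le _ _ _

theorem cellDist_comm (f : α → ι) (m₁ m₂ : Measure α) : cellDist f m₁ m₂ = cellDist f m₂ m₁ :=
  Finset.sum_congr rfl fun _ _ => abs_sub_comm _ _

theorem exists_cellDist_eq_integral_sub [MeasurableSpace ι] [MeasurableSingletonClass ι]
    {f : α → ι} (hf : Measurable f) (m m' : Measure α) [IsFiniteMeasure m] [IsFiniteMeasure m'] :
    ∃ G : ι → ℝ, (∀ i, |G i| ≤ 1) ∧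
      cellDist f m m' = ∫ x, G (f x) ∂m - ∫ x, G (f x) ∂m' := by
  let G : ι → ℝ := fun i => if 0 ≤ m.real (f ⁻¹' {i}) - m'.real (f ⁻¹' {i}) then 1 else -1
  refine ⟨G, fun i => ?_, ?_⟩
  · simp only [G]; split_ifs <;> simp
  rw [integral_comp_eq_sum hf, integral_comp_eq_sum hf, cellDist, ← Finset.sum_sub_distrib]
  refine Finset.sum_congr rfl fun i _ => ?_
  rw [← sub_mul]
  simp only [G]
  split_ifs with h
  · rw [abs_of_nonneg h, mul_one]
  · rw [abs_of_neg (not_le.1 h), mul_neg_one]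

end CellDist

section Pointwise

variable {d n : ℕ} {p τ : ℝ} {xs ys : Fin n → Rd d} {g : Rd d → ℝ} {κ : Kernel (Rd d) (Rd d)}
  {μ ν : Measure (Rd d)}

theorem dyadicDist_nonneg (J : ℕ) (m m' : Measure (Rd d)) : 0 ≤ dyadicDist J m m' :=
  mul_nonneg (Real.sqrt_nonneg _) (add_nonneg (by positivity)
    (Finset.sum_nonneg fun _ _ => mul_nonneg (by positivity) (cellDist_nonneg _ _ _)))

theorem Wp_le_of_isCoupling {π : Measure (Rd d × Rd d)} (hπ : IsCoupling π μ ν) :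
    Wp p μ ν ≤ (∫ z, ‖z.1 - z.2‖ ^ p ∂π) ^ (1 / p) := by
  refine csInf_le ⟨0, ?_⟩ ⟨π, hπ, rfl⟩
  rintro c ⟨π', -, rfl⟩
  exact Real.rpow_nonneg (integral_nonneg fun z => by positivity) _

theorem isCoupling_prod [IsProbabilityMeasure μ] [IsProbabilityMeasure ν] :
    IsCoupling (μ.prod ν) μ ν := by
  constructor
  · rw [← Measure.fst, Measure.fst_prod]
  · rw [← Measure.snd, Measure.snd_prod]

theorem isCoupling_diag : IsCoupling (ν.map fun x => (x, x)) ν ν := by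
  constructor <;>
  · rw [Measure.map_map (by fun_prop) (by fun_prop)]
    exact Measure.map_id

/-- Stochastic error controlling both gaps of the entropic kernel at cell scale `2⁻ʲ`. -/
def entGap (p τ : ℝ) (j J : ℕ) (μ ν : Measure (Rd d)) (xs ys : Fin n → Rd d) : ℝ :=
  2 * costLip d p * (2 * √d * (2 ^ j)⁻¹) +
    (√d) ^ p * (cellDist (cellIdx j) μ (empMeasure xs) + cellDist (cellIdx j) ν (empMeasure ys)) +
    τ * Real.log n +
    (costLip d p + 8 * costLip d p * (√d) ^ p / τ) * dyadicDist J μ (empMeasure xs)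

theorem entGap_nonneg (hp : 1 ≤ p) (hτ : 0 < τ) (j J : ℕ) : 0 ≤ entGap p τ j J μ ν xs ys := by
  have hL := costLip_nonneg (d := d) hp
  have hR := dyadicDist_nonneg J μ (empMeasure xs)
  have hTx := cellDist_nonneg (cellIdx j) μ (empMeasure xs)
  have hTy := cellDist_nonneg (cellIdx j) ν (empMeasure ys)
  have hlog : 0 ≤ Real.log n := Real.log_natCast_nonneg n
  unfold entGap
  positivity

variable [IsMarkovKernel κ] [IsProbabilityMeasure μ] [IsProbabilityMeasure ν]

theorem kernelCost_le (hn : n ≠ 0) (hp : 1 ≤ p) (hτ : 0 < τ) (hxs : ∀ i, xs i ∈ cube01 d)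
    (hys : ∀ j, ys j ∈ cube01 d) (hμ : ∀ᵐ x ∂μ, x ∈ cube01 d) (hν : ∀ᵐ x ∂ν, x ∈ cube01 d)
    (hmem : ∀ x, ∀ᵐ y ∂(κ x), y ∈ cube01 d)
    (hκ : ∀ x ∈ cube01 d, ∀ x' ∈ cube01 d,
      κ x ≤ ENNReal.ofReal (Real.exp (2 * costLip d p / τ * ‖x - x'‖)) • κ x')
    (hcoup : IsCoupling (kernelCoupling κ (empMeasure xs)) (empMeasure xs) (empMeasure ys))
    (hopt : ∀ π : Measure (Rd d × Rd d), IsCoupling π (empMeasure xs) (empMeasure ys) →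
      π ≪ (empMeasure xs).prod (empMeasure ys) →
      entObj p τ (kernelCoupling κ (empMeasure xs)) ((empMeasure xs).prod (empMeasure ys)) ≤
        entObj p τ π ((empMeasure xs).prod (empMeasure ys))) (j J : ℕ) :
    kernelCost p κ μ ≤ Wp p μ ν + entGap p τ j J μ ν xs ys ^ (1 / p) := by
  have := isProbabilityMeasure_empMeasure hn xs
  have := isProbabilityMeasure_empMeasure hn ys
  have hL := costLip_nonneg (d := d) hp
  have hR := dyadicDist_nonneg J μ (empMeasure xs)
  have hgap : 0 ≤ entGap p τ j J μ ν xs ys := entGap_nonneg hp hτ j J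
  have hxs' := ae_empMeasure (P := fun x => x ∈ cube01 d) hxs
  have hys' := ae_empMeasure (P := fun x => x ∈ cube01 d) hys
  have hFm : Measurable fun x => ∫ y, ‖x - y‖ ^ p ∂(κ x) :=
    (StronglyMeasurable.integral_kernel_prod_right' (κ := κ)
      (f := fun z : Rd d × Rd d => ‖z.1 - z.2‖ ^ p)
      (by fun_prop : Measurable _).stronglyMeasurable).measurable
  have hF := integral_le_integral_add_dyadicDist J hμ hxs' hFm
    (L := costLip d p + 4 * costLip d p * (√d) ^ p / τ) (by positivity)
    (fun x hx x' hx' => kernel_cost_lipschitz hp hτ hmem hκ hx hx')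
  have hkc : ∫ x, ∫ y, ‖x - y‖ ^ p ∂(κ x) ∂(empMeasure xs) =
      ∫ z, ‖z.1 - z.2‖ ^ p ∂(kernelCoupling κ (empMeasure xs)) := by
    have hP := hcoup.isProbabilityMeasure
    have hi : Integrable (fun z : Rd d × Rd d => ‖z.1 - z.2‖ ^ p)
        (kernelCoupling κ (empMeasure xs)) := by
      refine Integrable.of_bound (by fun_prop : Measurable fun z : Rd d × Rd d =>
        ‖z.1 - z.2‖ ^ p).aestronglyMeasurable ((√d) ^ p) ?_
      filter_upwards [hcoup.ae_mem hxs' hys'] with z hz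
      rw [Real.norm_of_nonneg (by positivity)]
      exact cost_le (by linarith) hz.1 hz.2
    rw [kernelCoupling_eq_compProd] at hi ⊢
    exact (Measure.integral_compProd hi).symm
  have hkl : 0 ≤ klDivR (kernelCoupling κ (empMeasure xs))
      ((empMeasure xs).prod (empMeasure ys)) := by
    have := hcoup.isProbabilityMeasure
    exact klDivR_nonneg (hcoup.absolutelyContinuous_prod_empMeasure hn)
  rw [← sub_le_iff_le_add]
  refine le_csInf ⟨_, μ.prod ν, isCoupling_prod, rfl⟩ ?_
  rintro _ ⟨π, hπ, rfl⟩
  obtain ⟨γ, hγ, hγc⟩ := exists_isCoupling_cost_le (measurable_cellIdx j) hp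
    (fun x hx y hy h => norm_sub_le_of_cellIdx_eq hx hy h) hμ hν hxs' hys' hπ
  have hγP := hγ.isProbabilityMeasure
  have ho := hopt γ hγ (hγ.absolutelyContinuous_prod_empMeasure hn)
  have hγkl := klDivR_le_log_of_le_smul (hγ.le_smul_prod_empMeasure hn)
  have h1 := mul_le_mul_of_nonneg_left hγkl hτ.le
  have h2 := mul_nonneg hτ.le hkl
  unfold entObj at ho
  have hcost : ∫ x, ∫ y, ‖x - y‖ ^ p ∂(κ x) ∂μ ≤
      ∫ z, ‖z.1 - z.2‖ ^ p ∂π + entGap p τ j J μ ν xs ys := by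
    have h3 : (costLip d p + 4 * costLip d p * (√d) ^ p / τ) * dyadicDist J μ (empMeasure xs) ≤
        (costLip d p + 8 * costLip d p * (√d) ^ p / τ) * dyadicDist J μ (empMeasure xs) := by
      gcongr; norm_num
    unfold entGap
    linarith
  rw [sub_le_iff_le_add]
  have hc0 : 0 ≤ ∫ z, ‖z.1 - z.2‖ ^ p ∂π := integral_nonneg fun z => by positivity
  calc kernelCost p κ μ ≤ (∫ z, ‖z.1 - z.2‖ ^ p ∂π + entGap p τ j J μ ν xs ys) ^ (1 / p) :=
        Real.rpow_le_rpow (integral_nonneg fun x => integral_nonneg fun y => by positivity)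
          hcost (by positivity)
    _ ≤ _ := Real.rpow_add_le_add_rpow hc0 hgap (by positivity)
        (by rw [div_le_one (by positivity)]; exact hp)

theorem Wp_kpush_le (hn : n ≠ 0) (hp : 1 ≤ p) (hτ : 0 < τ) (hxs : ∀ i, xs i ∈ cube01 d)
    (hμ : ∀ᵐ x ∂μ, x ∈ cube01 d) (hν : ∀ᵐ x ∂ν, x ∈ cube01 d)
    (hmem : ∀ x, ∀ᵐ y ∂(κ x), y ∈ cube01 d)
    (hκ : ∀ x ∈ cube01 d, ∀ x' ∈ cube01 d,
      κ x ≤ ENNReal.ofReal (Real.exp (2 * costLip d p / τ * ‖x - x'‖)) • κ x')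
    (hcoup : IsCoupling (kernelCoupling κ (empMeasure xs)) (empMeasure xs) (empMeasure ys))
    (j J : ℕ) :
    Wp p (kpush κ μ) ν ≤ entGap p τ j J μ ν xs ys ^ (1 / p) := by
  have := isProbabilityMeasure_empMeasure hn xs
  have := isProbabilityMeasure_empMeasure hn ys
  have := isProbabilityMeasure_kpush (κ := κ) (m := μ)
  have hL := costLip_nonneg (d := d) hp
  have hR := dyadicDist_nonneg J μ (empMeasure xs)
  have hTx := cellDist_nonneg (cellIdx j) μ (empMeasure xs)
  have hlog : 0 ≤ Real.log n := Real.log_natCast_nonneg n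
  have hpush : kpush κ (empMeasure xs) = empMeasure ys := by
    rw [kpush_eq_snd_compProd, ← kernelCoupling_eq_compProd]
    exact hcoup.2
  have hpm := ae_mem_kpush (m := μ) measurableSet_cube01 hmem
  obtain ⟨γ, hγ, hγc⟩ := exists_isCoupling_cost_le (measurable_cellIdx j) hp
    (fun x hx y hy h => norm_sub_le_of_cellIdx_eq hx hy h) hν hν hpm hν isCoupling_diag
  refine (Wp_le_of_isCoupling hγ).trans ?_
  refine Real.rpow_le_rpow (integral_nonneg fun z => by positivity) (hγc.trans ?_) (by positivity)
  have h0 : ∫ z, ‖z.1 - z.2‖ ^ p ∂(ν.map fun x => (x, x)) = 0 := by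
    rw [integral_map (by fun_prop) (by fun_prop : Measurable fun z : Rd d × Rd d =>
        ‖z.1 - z.2‖ ^ p).aestronglyMeasurable]
    simp [Real.zero_rpow (by linarith : p ≠ 0)]
  have hself : cellDist (cellIdx j) ν ν = 0 := by simp [cellDist]
  obtain ⟨G, hG, hGe⟩ := exists_cellDist_eq_integral_sub (measurable_cellIdx j) (kpush κ μ)
    (empMeasure ys)
  have hGm : Measurable fun y : Rd d => G (cellIdx j y) :=
    (measurable_of_finite G).comp (measurable_cellIdx j)
  rw [← hpush, integral_kpush hGm (fun y => hG _), integral_kpush hGm (fun y => hG _), hpush] at hGe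
  have hH := integral_le_integral_add_dyadicDist J hμ
    (ae_empMeasure (P := fun x => x ∈ cube01 d) hxs)
    (F := fun x => ∫ y, G (cellIdx j y) ∂(κ x))
    (hGm.stronglyMeasurable.integral_kernel).measurable (L := 8 * costLip d p / τ) (by positivity)
    (fun x hx x' hx' => kernel_integral_lipschitz hp hτ hκ hGm (fun y => hG _) hx hx')
  have htri := cellDist_triangle (cellIdx j) ν (empMeasure ys) (kpush κ μ)
  rw [cellDist_comm (cellIdx j) (empMeasure ys)] at htri
  have hle : cellDist (cellIdx j) ν (kpush κ μ) ≤ cellDist (cellIdx j) ν (empMeasure ys) +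
      8 * costLip d p / τ * dyadicDist J μ (empMeasure xs) := by linarith
  have h3 := mul_le_mul_of_nonneg_left hle (Real.rpow_nonneg (Real.sqrt_nonneg d) p)
  have h4 : 0 ≤ (√d) ^ p * cellDist (cellIdx j) μ (empMeasure xs) := by positivity
  have h5 : 0 ≤ τ * Real.log n := by positivity
  have h6 : 0 ≤ costLip d p * dyadicDist J μ (empMeasure xs) := by positivity
  have h7 : (√d) ^ p * (8 * costLip d p / τ * dyadicDist J μ (empMeasure xs)) =
    8 * costLip d p * (√d) ^ p / τ * dyadicDist J μ (empMeasure xs) := by ring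
  rw [h0, hself, add_zero, entGap]
  linarith

theorem Ep_le_two_mul_entGap_rpow (hn : n ≠ 0) (hp : 1 ≤ p) (hτ : 0 < τ)
    (hxs : ∀ i, xs i ∈ cube01 d) (hys : ∀ j, ys j ∈ cube01 d)
    (hμ : ∀ᵐ x ∂μ, x ∈ cube01 d) (hν : ∀ᵐ x ∂ν, x ∈ cube01 d)
    (hκ : ∀ x, κ x = (empMeasure ys).withDensity (fun y =>
      ENNReal.ofReal (Real.exp ((g y - ‖x - y‖ ^ p) / τ) /
        ∫ y', Real.exp ((g y' - ‖x - y'‖ ^ p) / τ) ∂(empMeasure ys))))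
    (hcoup : IsCoupling (kernelCoupling κ (empMeasure xs)) (empMeasure xs) (empMeasure ys))
    (hopt : ∀ π : Measure (Rd d × Rd d), IsCoupling π (empMeasure xs) (empMeasure ys) →
      π ≪ (empMeasure xs).prod (empMeasure ys) →
      entObj p τ (kernelCoupling κ (empMeasure xs)) ((empMeasure xs).prod (empMeasure ys)) ≤
        entObj p τ π ((empMeasure xs).prod (empMeasure ys))) (j J : ℕ) :
    Ep p κ μ ν ≤ 2 * entGap p τ j J μ ν xs ys ^ (1 / p) := by
  have hmem := softmax_kernel_ae_mem hys hκ
  have hle : ∀ x ∈ cube01 d, ∀ x' ∈ cube01 d,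
      κ x ≤ ENNReal.ofReal (Real.exp (2 * costLip d p / τ * ‖x - x'‖)) • κ x' :=
    fun x hx x' hx' => softmax_kernel_le_smul hn hp hτ hys hκ hx hx'
  have h1 := kernelCost_le hn hp hτ hxs hys hμ hν hmem hle hcoup hopt j J
  have h2 := Wp_kpush_le hn hp hτ hxs hμ hν hmem hle hcoup j J
  have h3 : 0 ≤ entGap p τ j J μ ν xs ys ^ (1 / p) :=
    Real.rpow_nonneg (entGap_nonneg hp hτ j J) _
  have h4 : max (kernelCost p κ μ - Wp p μ ν) 0 ≤ entGap p τ j J μ ν xs ys ^ (1 / p) :=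
    max_le (by linarith) h3
  unfold Ep
  linarith

end Pointwise

section Sampling

variable {d n : ℕ} {μ ν : Measure (Rd d)} [IsProbabilityMeasure μ] [IsProbabilityMeasure ν]

theorem measureReal_empMeasure {A : Set (Rd d)} (hA : MeasurableSet A) (xs : Fin n → Rd d) :
    (empMeasure xs).real A = (n : ℝ)⁻¹ * ∑ i, A.indicator (1 : Rd d → ℝ) (xs i) := by
  rw [← integral_indicator_one hA, integral_empMeasure]

theorem measurable_measureReal_empMeasure {A : Set (Rd d)} (hA : MeasurableSet A) :
    Measurable fun xs : Fin n → Rd d => (empMeasure xs).real A := by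
  simp only [measureReal_empMeasure hA]
  refine (Finset.measurable_sum _ fun i _ => ?_).const_mul _
  exact (measurable_one.indicator hA).comp (measurable_pi_apply i)

theorem integral_abs_le_sqrt_integral_sq {Ω : Type*} [MeasurableSpace Ω] {P : Measure Ω}
    [IsProbabilityMeasure P] {f : Ω → ℝ} (hf : MemLp f 2 P) :
    ∫ ω, |f ω| ∂P ≤ √(∫ ω, f ω ^ 2 ∂P) := by
  have h := variance_nonneg (fun ω => |f ω|) P
  rw [variance_eq_sub (by simpa using hf.norm)] at h
  refine Real.le_sqrt_of_sq_le ?_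
  simp only [Pi.pow_apply, sq_abs] at h
  linarith

theorem integral_abs_measureReal_sub_empMeasure_le (hn : n ≠ 0) {A : Set (Rd d)}
    (hA : MeasurableSet A) :
    ∫ xs, |μ.real A - (empMeasure xs).real A| ∂(Measure.pi fun _ : Fin n => μ) ≤
      √(μ.real A / n) := by
  set X : Rd d → ℝ := A.indicator 1 with hX
  have hXm : Measurable X := measurable_one.indicator hA
  have hX01 : ∀ x, X x ∈ Icc (0 : ℝ) 1 := fun x => by
    simp only [hX, indicator]; split_ifs <;> simp
  have hXL : MemLp X 2 μ := memLp_of_bounded (Filter.Eventually.of_forall hX01)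
    hXm.aestronglyMeasurable 2
  have hXE : ∫ x, X x ∂μ = μ.real A := integral_indicator_one hA
  set P := Measure.pi fun _ : Fin n => μ with hP
  have hn' : (n : ℝ) ≠ 0 := by exact_mod_cast hn
  let Z : (Fin n → Rd d) → ℝ := fun xs => (empMeasure xs).real A
  have hZe : Z = fun xs => (n : ℝ)⁻¹ * (∑ i, fun ω : Fin n → Rd d => X (ω i)) xs := by
    funext xs; simp only [Z, measureReal_empMeasure hA, Finset.sum_apply, hX]
  have hZm : Measurable Z := measurable_measureReal_empMeasure hA
  have hE : ∀ i : Fin n, ∫ ω, X (ω i) ∂P = μ.real A := fun i => by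
    rw [← hXE, ← (measurePreserving_eval (fun _ : Fin n => μ) i).map_eq,
      integral_map (measurable_pi_apply i).aemeasurable hXm.aestronglyMeasurable]
  have hZE : P[Z] = μ.real A := by
    rw [hZe, integral_const_mul]
    simp only [Finset.sum_apply]
    rw [integral_finsetSum]
    · rw [Finset.sum_congr rfl fun i _ => hE i]
      simp only [Finset.sum_const, Finset.card_univ, Fintype.card_fin, nsmul_eq_mul]
      field_simp
    · exact fun i _ => (measurePreserving_eval (fun _ : Fin n => μ) i).integrable_comp_of_integrable
        (hXL.integrable (by norm_num))
  have hZV : Var[Z; P] ≤ μ.real A / n := by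
    rw [hZe, variance_const_mul, variance_sum_pi fun _ => hXL]
    have := variance_le_sub_mul_sub (Filter.Eventually.of_forall hX01) hXm.aemeasurable (μ := μ)
    rw [hXE] at this
    have h1 : Var[X; μ] ≤ μ.real A := by nlinarith [measureReal_nonneg (μ := μ) (s := A)]
    simp only [Finset.sum_const, Finset.card_univ, Fintype.card_fin, nsmul_eq_mul]
    calc ((n : ℝ)⁻¹) ^ 2 * (n * Var[X; μ]) = Var[X; μ] / n := by field_simp
      _ ≤ _ := by gcongr
  have hb : ∀ xs, ‖μ.real A - Z xs‖ ≤ 1 := fun xs => by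
    have := isProbabilityMeasure_empMeasure hn xs
    have h1 : Z xs ≤ 1 := measureReal_le_one
    have h2 : μ.real A ≤ 1 := measureReal_le_one
    have h3 : 0 ≤ Z xs := measureReal_nonneg
    have h4 : 0 ≤ μ.real A := measureReal_nonneg
    rw [Real.norm_eq_abs, abs_le]
    constructor <;> linarith
  have hL : MemLp (fun xs => μ.real A - Z xs) 2 P :=
    MemLp.of_bound (by fun_prop) 1 (Filter.Eventually.of_forall hb)
  refine (integral_abs_le_sqrt_integral_sq hL).trans (Real.sqrt_le_sqrt ?_)
  rw [variance_eq_integral hZm.aemeasurable, hZE] at hZV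
  simpa only [sub_sq_comm] using hZV

variable {ι : Type*} [Fintype ι] [MeasurableSpace ι] [MeasurableSingletonClass ι]
  {f : Rd d → ι}

theorem integrable_abs_measureReal_sub_empMeasure (hn : n ≠ 0) {A : Set (Rd d)}
    (hA : MeasurableSet A) :
    Integrable (fun xs => |μ.real A - (empMeasure xs).real A|)
      (Measure.pi fun _ : Fin n => μ) := by
  have := measurable_measureReal_empMeasure (n := n) hA
  refine Integrable.of_bound (by fun_prop : Measurable _).aestronglyMeasurable 1 ?_
  refine Filter.Eventually.of_forall fun xs => ?_
  have := isProbabilityMeasure_empMeasure hn xs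
  have h1 : (empMeasure xs).real A ≤ 1 := measureReal_le_one
  have h2 : μ.real A ≤ 1 := measureReal_le_one
  have h3 : 0 ≤ (empMeasure xs).real A := measureReal_nonneg
  have h4 : 0 ≤ μ.real A := measureReal_nonneg
  rw [Real.norm_eq_abs, abs_abs, abs_le]
  constructor <;> linarith

theorem integrable_cellDist_empMeasure (hn : n ≠ 0) (hf : Measurable f) :
    Integrable (fun xs => cellDist f μ (empMeasure xs)) (Measure.pi fun _ : Fin n => μ) :=
  integrable_finsetSum _ fun i _ =>
    integrable_abs_measureReal_sub_empMeasure hn (hf (measurableSet_singleton i))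

theorem integral_cellDist_empMeasure_le (hn : n ≠ 0) (hf : Measurable f) :
    ∫ xs, cellDist f μ (empMeasure xs) ∂(Measure.pi fun _ : Fin n => μ) ≤
      √(Fintype.card ι / n) := by
  have hA : ∀ i, MeasurableSet (f ⁻¹' {i}) := fun i => hf (measurableSet_singleton i)
  unfold cellDist
  rw [integral_finsetSum _ fun i _ => integrable_abs_measureReal_sub_empMeasure hn (hA i)]
  refine (Finset.sum_le_sum fun i _ =>
    integral_abs_measureReal_sub_empMeasure_le hn (hA i)).trans ?_
  refine Real.le_sqrt_of_sq_le ((sq_sum_le_card_mul_sum_sq).trans ?_)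
  have h1 : ∑ i, √(μ.real (f ⁻¹' {i}) / n) ^ 2 = (∑ i, μ.real (f ⁻¹' {i})) / n := by
    rw [Finset.sum_div]
    exact Finset.sum_congr rfl fun i _ => Real.sq_sqrt (by positivity)
  have h2 : ∑ i, μ.real (f ⁻¹' {i}) = 1 := by
    rw [sum_measureReal_preimage_singleton _ (fun i _ => hA i)]
    simp
  rw [h1, h2, Finset.card_univ, mul_one_div]

theorem integrable_dyadicDist_empMeasure (hn : n ≠ 0) (J : ℕ) :
    Integrable (fun xs => dyadicDist J μ (empMeasure xs)) (Measure.pi fun _ : Fin n => μ) :=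
  ((integrable_const _).add (integrable_finsetSum _ fun j _ =>
    (integrable_cellDist_empMeasure hn (measurable_cellIdx j)).const_mul _)).const_mul _

theorem integral_dyadicDist_empMeasure_le (hn : n ≠ 0) (J : ℕ) :
    ∫ xs, dyadicDist J μ (empMeasure xs) ∂(Measure.pi fun _ : Fin n => μ) ≤
      √d * (2 * (2 ^ J)⁻¹ + ∑ j ∈ Finset.range (J + 1),
        (2 ^ j)⁻¹ * √(2 ^ d * (2 ^ j) ^ d / n)) := by
  unfold dyadicDist
  have hi : ∀ j ∈ Finset.range (J + 1), Integrable (fun xs : Fin n → Rd d =>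
      ((2 : ℝ) ^ j)⁻¹ * cellDist (cellIdx j) μ (empMeasure xs)) (Measure.pi fun _ => μ) :=
    fun j _ => (integrable_cellDist_empMeasure hn (measurable_cellIdx j)).const_mul _
  rw [integral_const_mul, integral_add (integrable_const _) (integrable_finsetSum _ hi),
    integral_finsetSum _ hi]
  simp only [integral_const, probReal_univ, smul_eq_mul, one_mul, integral_const_mul]
  gcongr with j _
  refine (integral_cellDist_empMeasure_le hn (measurable_cellIdx j)).trans ?_
  gcongr
  exact card_cellIdx_le j

theorem integrable_entGap (hn : n ≠ 0) (p τ : ℝ) (j J : ℕ) :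
    Integrable (fun ω : (Fin n → Rd d) × (Fin n → Rd d) => entGap p τ j J μ ν ω.1 ω.2)
      ((Measure.pi fun _ : Fin n => μ).prod (Measure.pi fun _ : Fin n => ν)) := by
  have h1 := (integrable_cellDist_empMeasure (μ := μ) hn (measurable_cellIdx j)).comp_fst
    (Measure.pi fun _ : Fin n => ν)
  have h2 := (integrable_cellDist_empMeasure (μ := ν) hn (measurable_cellIdx j)).comp_snd
    (Measure.pi fun _ : Fin n => μ)
  have h3 := (integrable_dyadicDist_empMeasure (μ := μ) hn J).comp_fst
    (Measure.pi fun _ : Fin n => ν)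
  exact (((integrable_const _).add ((h1.add h2).const_mul _)).add (integrable_const _)).add
    (h3.const_mul _)

theorem integral_entGap_le (hn : n ≠ 0) {p τ : ℝ} (hp : 1 ≤ p) (hτ : 0 < τ) (j J : ℕ) :
    ∫ ω, entGap p τ j J μ ν ω.1 ω.2
      ∂((Measure.pi fun _ : Fin n => μ).prod (Measure.pi fun _ : Fin n => ν)) ≤
      2 * costLip d p * (2 * √d * (2 ^ j)⁻¹) +
      (√d) ^ p * (2 * √(2 ^ d * (2 ^ j) ^ d / n)) + τ * Real.log n +
      (costLip d p + 8 * costLip d p * (√d) ^ p / τ) *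
        (√d * (2 * (2 ^ J)⁻¹ + ∑ j ∈ Finset.range (J + 1),
          (2 ^ j)⁻¹ * √(2 ^ d * (2 ^ j) ^ d / n))) := by
  have hL := costLip_nonneg (d := d) hp
  have h1 := (integrable_cellDist_empMeasure (μ := μ) hn (measurable_cellIdx j)).comp_fst
    (Measure.pi fun _ : Fin n => ν)
  have h2 := (integrable_cellDist_empMeasure (μ := ν) hn (measurable_cellIdx j)).comp_snd
    (Measure.pi fun _ : Fin n => μ)
  have h3 := (integrable_dyadicDist_empMeasure (μ := μ) hn J).comp_fst
    (Measure.pi fun _ : Fin n => ν)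
  have e1 := integral_fun_fst (μ := Measure.pi fun _ : Fin n => μ)
    (ν := Measure.pi fun _ : Fin n => ν) fun xs => cellDist (cellIdx j) μ (empMeasure xs)
  have e2 := integral_fun_snd (μ := Measure.pi fun _ : Fin n => μ)
    (ν := Measure.pi fun _ : Fin n => ν) fun ys => cellDist (cellIdx j) ν (empMeasure ys)
  have e3 := integral_fun_fst (μ := Measure.pi fun _ : Fin n => μ)
    (ν := Measure.pi fun _ : Fin n => ν) fun xs => dyadicDist J μ (empMeasure xs)
  simp only [probReal_univ, one_smul] at e1 e2 e3
  have hc := card_cellIdx_le (d := d) j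
  have hcell : ∀ (m : Measure (Rd d)) [IsProbabilityMeasure m],
      ∫ xs, cellDist (cellIdx j) m (empMeasure xs) ∂(Measure.pi fun _ : Fin n => m) ≤
        √(2 ^ d * (2 ^ j) ^ d / n) := fun m _ =>
    (integral_cellDist_empMeasure_le hn (measurable_cellIdx j)).trans (by gcongr)
  have b1 := hcell μ
  have b2 := hcell ν
  have b3 := integral_dyadicDist_empMeasure_le (μ := μ) hn J
  unfold entGap
  rw [integral_add, integral_add, integral_add]
  · simp only [integral_const_mul, integral_const, probReal_univ, smul_eq_mul, one_mul]
    rw [integral_add h1 h2, e1, e2, e3]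
    gcongr
    linarith
  · exact integrable_const _
  · exact (h1.add h2).const_mul _
  · exact (integrable_const _).add ((h1.add h2).const_mul _)
  · exact integrable_const _
  · exact ((integrable_const _).add ((h1.add h2).const_mul _)).add (integrable_const _)
  · exact h3.const_mul _

theorem ae_pi_forall_mem {A : Set (Rd d)} (h : ∀ᵐ x ∂μ, x ∈ A) :
    ∀ᵐ xs ∂(Measure.pi fun _ : Fin n => μ), ∀ i, xs i ∈ A :=
  ae_all_iff.2 fun i => (Measure.quasiMeasurePreserving_eval (fun _ : Fin n => μ) i).ae h

end Sampling

section Rates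

theorem inv_mul_sqrt_pow_div_le {d m : ℕ} (hdm : d ≤ m) (hm : 2 ≤ m) {s q : ℝ} (hq : 1 ≤ q)
    (hqs : q ≤ s ^ 2) : q⁻¹ * √(2 ^ d * q ^ d / s ^ (2 * m)) ≤ √(2 ^ d) * (s ^ 2)⁻¹ := by
  have hs : 0 < s ^ 2 := by linarith
  rw [← Real.sqrt_sq (inv_nonneg.2 hs.le), ← Real.sqrt_mul (by positivity),
    ← Real.sqrt_sq (inv_nonneg.2 (zero_le_one.trans hq)), ← Real.sqrt_mul (by positivity)]
  refine Real.sqrt_le_sqrt ?_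
  obtain ⟨k, rfl⟩ := Nat.exists_eq_add_of_le hm
  have h1 : q ^ d ≤ q ^ (2 + k) := pow_le_pow_right₀ hq hdm
  have h2 : q ^ k ≤ (s ^ 2) ^ k := by gcongr
  calc (q⁻¹) ^ 2 * (2 ^ d * q ^ d / s ^ (2 * (2 + k)))
      ≤ (q⁻¹) ^ 2 * (2 ^ d * q ^ (2 + k) / s ^ (2 * (2 + k))) := by
        rw [pow_mul]; gcongr
    _ = 2 ^ d * q ^ k / (s ^ 2) ^ (2 + k) := by
        rw [pow_mul, pow_add]; field_simp
    _ ≤ 2 ^ d * (s ^ 2) ^ k / (s ^ 2) ^ (2 + k) := by gcongr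
    _ = 2 ^ d * ((s ^ 2)⁻¹) ^ 2 := by rw [pow_add]; field_simp

theorem sqrt_pow_div_le {d m : ℕ} (hdm : d ≤ m) (hm : 2 ≤ m) {s q : ℝ} (hq : 1 ≤ q)
    (hqs : q ≤ s) : √(2 ^ d * q ^ d / s ^ (2 * m)) ≤ √(2 ^ d) * s⁻¹ := by
  have hs : 1 ≤ s := hq.trans hqs
  have hs0 : 0 < s := by linarith
  rw [← Real.sqrt_sq (inv_nonneg.2 hs0.le), ← Real.sqrt_mul (by positivity)]
  refine Real.sqrt_le_sqrt ?_
  have h1 : q ^ d ≤ s ^ m := (pow_le_pow_left₀ (by linarith) hqs d).trans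
    (pow_le_pow_right₀ hs hdm)
  have h2 : s ^ 2 ≤ s ^ m := pow_le_pow_right₀ hs hm
  calc 2 ^ d * q ^ d / s ^ (2 * m) ≤ 2 ^ d * s ^ m / s ^ (2 * m) := by gcongr
    _ = 2 ^ d * (s ^ m)⁻¹ := by rw [two_mul, pow_add]; field_simp
    _ ≤ 2 ^ d * (s ^ 2)⁻¹ := by gcongr
    _ = 2 ^ d * (s⁻¹) ^ 2 := by rw [inv_pow]

/-- Constant in the rate for the expected gap of the entropic kernel. -/
def entGapConst (d : ℕ) (p D : ℝ) : ℝ :=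
  8 * costLip d p * √d + 2 * (√d) ^ p * √(2 ^ d) + D +
    (costLip d p + 8 * costLip d p * (√d) ^ p) * (√d * (8 + 2 * √(2 ^ d)))

theorem exists_scales_entGap_bound_le {d m : ℕ} (hdm : d ≤ m) (hm : 2 ≤ m) {p s ℓ D : ℝ}
    (hp : 1 ≤ p) (hs : 1 ≤ s) (hℓ : 1 ≤ ℓ) (hsℓ : 2 * Real.log s ≤ Real.log 2 * ℓ) (hD : 1 ≤ D) :
    ∃ j J : ℕ, 2 * costLip d p * (2 * √d * (2 ^ j)⁻¹) +
      (√d) ^ p * (2 * √(2 ^ d * (2 ^ j) ^ d / s ^ (2 * m))) + D * s⁻¹ * ℓ * ℓ +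
      (costLip d p + 8 * costLip d p * (√d) ^ p / (D * s⁻¹ * ℓ)) *
        (√d * (2 * (2 ^ J)⁻¹ + ∑ i ∈ Finset.range (J + 1),
          (2 ^ i)⁻¹ * √(2 ^ d * (2 ^ i) ^ d / s ^ (2 * m)))) ≤
      entGapConst d p D * s⁻¹ * ℓ ^ 2 := by
  have hs0 : 0 < s := by linarith
  have hL := costLip_nonneg (d := d) hp
  obtain ⟨j, hj1, hj2⟩ := exists_nat_pow_near hs (one_lt_two)
  refine ⟨j, 2 * j, ?_⟩
  have hjinv : ((2 : ℝ) ^ j)⁻¹ ≤ 2 * s⁻¹ := by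
    rw [pow_succ] at hj2
    rw [← div_eq_mul_inv, inv_eq_one_div, div_le_div_iff₀ (by positivity) hs0]
    linarith
  have hJinv : ((2 : ℝ) ^ (2 * j))⁻¹ ≤ 4 * (s ^ 2)⁻¹ := by
    calc ((2 : ℝ) ^ (2 * j))⁻¹ = (((2 : ℝ) ^ j)⁻¹) ^ 2 := by rw [mul_comm, pow_mul, inv_pow]
      _ ≤ (2 * s⁻¹) ^ 2 := by gcongr
      _ = _ := by rw [mul_pow, inv_pow]; norm_num
  have hjℓ : 2 * (j : ℝ) ≤ ℓ := by
    have h := Real.log_le_log (by positivity) hj1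
    rw [Real.log_pow] at h
    have h2 : 0 < Real.log 2 := Real.log_pos one_lt_two
    nlinarith
  have hterm : ∀ i ∈ Finset.range (2 * j + 1),
      ((2 : ℝ) ^ i)⁻¹ * √(2 ^ d * (2 ^ i) ^ d / s ^ (2 * m)) ≤ √(2 ^ d) * (s ^ 2)⁻¹ := by
    intro i hi
    refine inv_mul_sqrt_pow_div_le hdm hm (one_le_pow₀ one_le_two) ?_
    calc (2 : ℝ) ^ i ≤ 2 ^ (2 * j) :=
          pow_le_pow_right₀ one_le_two (Nat.lt_succ_iff.1 (Finset.mem_range.1 hi))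
      _ = (2 ^ j) ^ 2 := by rw [mul_comm, pow_mul]
      _ ≤ s ^ 2 := by gcongr
  have hsum : √d * (2 * ((2 : ℝ) ^ (2 * j))⁻¹ + ∑ i ∈ Finset.range (2 * j + 1),
      ((2 : ℝ) ^ i)⁻¹ * √(2 ^ d * (2 ^ i) ^ d / s ^ (2 * m))) ≤
      √d * (8 + 2 * √(2 ^ d)) * (ℓ * (s ^ 2)⁻¹) := by
    have h1 := Finset.sum_le_card_nsmul _ _ _ hterm
    rw [Finset.card_range, nsmul_eq_mul] at h1
    push_cast at h1
    have h2 : (2 * (j : ℝ) + 1) * (√(2 ^ d) * (s ^ 2)⁻¹) ≤ 2 * ℓ * (√(2 ^ d) * (s ^ 2)⁻¹) := by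
      gcongr; linarith
    have h3 : 8 * (s ^ 2)⁻¹ ≤ 8 * (ℓ * (s ^ 2)⁻¹) := by
      have : 0 ≤ (s ^ 2)⁻¹ := by positivity
      nlinarith
    rw [mul_assoc]
    gcongr
    linarith
  have hcoef : 8 * costLip d p * (√d) ^ p / (D * s⁻¹ * ℓ) ≤
      8 * costLip d p * (√d) ^ p * (s * ℓ⁻¹) := by
    rw [div_eq_mul_inv, mul_inv, mul_inv, inv_inv]
    have : D⁻¹ ≤ 1 := inv_le_one_of_one_le₀ hD
    have h2 : D⁻¹ * s * ℓ⁻¹ ≤ 1 * s * ℓ⁻¹ := by gcongr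
    rw [one_mul] at h2
    gcongr
  have hK : 0 ≤ √d * (8 + 2 * √(2 ^ d)) := by positivity
  have hss : (s ^ 2)⁻¹ ≤ s⁻¹ := by
    rw [inv_le_inv₀ (by positivity) hs0]; nlinarith
  have hℓ2 : ℓ ≤ ℓ ^ 2 := by nlinarith
  have hℓ3 : 1 ≤ ℓ ^ 2 := by nlinarith
  have t1 : 2 * costLip d p * (2 * √d * (2 ^ j)⁻¹) ≤ 8 * costLip d p * √d * s⁻¹ * ℓ ^ 2 := by
    calc _ ≤ 2 * costLip d p * (2 * √d * (2 * s⁻¹)) := by gcongr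
      _ = 8 * costLip d p * √d * s⁻¹ * 1 := by ring
      _ ≤ _ := by gcongr
  have t2 : (√d) ^ p * (2 * √(2 ^ d * (2 ^ j) ^ d / s ^ (2 * m))) ≤
      2 * (√d) ^ p * √(2 ^ d) * s⁻¹ * ℓ ^ 2 := by
    calc _ ≤ (√d) ^ p * (2 * (√(2 ^ d) * s⁻¹)) := by
          gcongr
          exact sqrt_pow_div_le hdm hm (one_le_pow₀ one_le_two) hj1
      _ = 2 * (√d) ^ p * √(2 ^ d) * s⁻¹ * 1 := by ring
      _ ≤ _ := by gcongr
  have t3 : (costLip d p + 8 * costLip d p * (√d) ^ p / (D * s⁻¹ * ℓ)) *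
        (√d * (2 * ((2 : ℝ) ^ (2 * j))⁻¹ + ∑ i ∈ Finset.range (2 * j + 1),
          ((2 : ℝ) ^ i)⁻¹ * √(2 ^ d * (2 ^ i) ^ d / s ^ (2 * m)))) ≤
      (costLip d p + 8 * costLip d p * (√d) ^ p) * (√d * (8 + 2 * √(2 ^ d))) * s⁻¹ * ℓ ^ 2 := by
    calc _ ≤ (costLip d p + 8 * costLip d p * (√d) ^ p * (s * ℓ⁻¹)) *
          (√d * (8 + 2 * √(2 ^ d)) * (ℓ * (s ^ 2)⁻¹)) := by gcongr
      _ = costLip d p * (√d * (8 + 2 * √(2 ^ d))) * (s ^ 2)⁻¹ * ℓ +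
          8 * costLip d p * (√d) ^ p * (√d * (8 + 2 * √(2 ^ d))) * s⁻¹ * 1 := by field_simp
      _ ≤ costLip d p * (√d * (8 + 2 * √(2 ^ d))) * s⁻¹ * ℓ ^ 2 +
          8 * costLip d p * (√d) ^ p * (√d * (8 + 2 * √(2 ^ d))) * s⁻¹ * ℓ ^ 2 := by gcongr
      _ = _ := by ring
  calc _ ≤ 8 * costLip d p * √d * s⁻¹ * ℓ ^ 2 + 2 * (√d) ^ p * √(2 ^ d) * s⁻¹ * ℓ ^ 2 +
        D * s⁻¹ * ℓ * ℓ + (costLip d p + 8 * costLip d p * (√d) ^ p) *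
          (√d * (8 + 2 * √(2 ^ d))) * s⁻¹ * ℓ ^ 2 := by gcongr
    _ = _ := by unfold entGapConst; ring

theorem rpow_one_div_le_mul_one_add {p z a : ℝ} (hp : 1 ≤ p) (hz : 0 ≤ z) (ha : 0 < a) :
    z ^ (1 / p) ≤ a ^ (1 / p) * (1 + z / a) := by
  have hp' : 1 / p ≤ 1 := by rw [div_le_one (by positivity)]; exact hp
  have h0 : 0 ≤ z / a := by positivity
  have h : (z / a) ^ (1 / p) ≤ 1 + z / a := by
    rcases le_total (z / a) 1 with h | h
    · have := Real.rpow_le_one h0 h (by positivity : 0 ≤ 1 / p)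
      linarith
    · have := Real.rpow_le_rpow_of_exponent_le h hp'
      rw [Real.rpow_one] at this
      linarith
  calc z ^ (1 / p) = a ^ (1 / p) * (z / a) ^ (1 / p) := by
        rw [← Real.mul_rpow ha.le h0, mul_div_cancel₀ _ ha.ne']
    _ ≤ _ := by gcongr

end Rates

/-- Risk bound for the entropic kernel estimator: with regularization
`τ = d^{p/4} n^{−1/(2d ∨ 4)} log n`, the conditional kernel of the optimal entropic coupling
between the empirical measures, given by the entropic-potential (softmax) formula, satisfies
`E[E_p(κ̂_n;μ,ν)] ≤ C_{p,d} n^{−1/(2pd ∨ 4p)} (log n)²`. -/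
theorem entropic_kernel_estimator {d : ℕ} (hd : 1 ≤ d) {p : ℝ} (hp : 1 ≤ p) :
    ∃ C : ℝ, 0 < C ∧
      ∀ (n : ℕ), 3 ≤ n →
      ∀ (X Y : Set (Rd d)), MeasurableSet X → MeasurableSet Y →
        X ⊆ cube01 d → Y ⊆ cube01 d →
      ∀ (μ ν : Measure (Rd d)), IsProbabilityMeasure μ → IsProbabilityMeasure ν →
        μ X = 1 → ν Y = 1 →
      ∀ (g : (Fin n → Rd d) → (Fin n → Rd d) → Rd d → ℝ)
        (κhat : (Fin n → Rd d) → (Fin n → Rd d) → Kernel (Rd d) (Rd d)),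
      (∀ xs ys, IsMarkovKernel (κhat xs ys)) →
      -- the estimated kernel is given by the entropic-potential softmax formula
      (∀ xs ys : Fin n → Rd d, ∀ x : Rd d,
        κhat xs ys x = (empMeasure ys).withDensity (fun y =>
          ENNReal.ofReal (Real.exp ((g xs ys y - ‖x - y‖ ^ p) /
              ((d : ℝ) ^ (p / 4) * (n : ℝ) ^ (-(1 : ℝ) / max (2 * (d : ℝ)) 4) * Real.log n)) /
            ∫ y', Real.exp ((g xs ys y' - ‖x - y'‖ ^ p) /
              ((d : ℝ) ^ (p / 4) * (n : ℝ) ^ (-(1 : ℝ) / max (2 * (d : ℝ)) 4) * Real.log n))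
              ∂(empMeasure ys)))) →
      -- the induced coupling is the optimal coupling for `S_{p,τ}(μ̂_n, ν̂_n)`
      (∀ xs ys : Fin n → Rd d,
        IsCoupling (kernelCoupling (κhat xs ys) (empMeasure xs)) (empMeasure xs)
          (empMeasure ys) ∧
        ∀ π : Measure (Rd d × Rd d), IsCoupling π (empMeasure xs) (empMeasure ys) →
          π ≪ (empMeasure xs).prod (empMeasure ys) →
          entObj p ((d : ℝ) ^ (p / 4) * (n : ℝ) ^ (-(1 : ℝ) / max (2 * (d : ℝ)) 4) * Real.log n)
              (kernelCoupling (κhat xs ys) (empMeasure xs))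
              ((empMeasure xs).prod (empMeasure ys)) ≤
            entObj p
              ((d : ℝ) ^ (p / 4) * (n : ℝ) ^ (-(1 : ℝ) / max (2 * (d : ℝ)) 4) * Real.log n)
              π ((empMeasure xs).prod (empMeasure ys))) →
      (∫ ω, Ep p (κhat ω.1 ω.2) μ ν
          ∂((Measure.pi fun _ : Fin n => μ).prod (Measure.pi fun _ : Fin n => ν))) ≤
        C * (n : ℝ) ^ (-(1 : ℝ) / max (2 * p * (d : ℝ)) (4 * p)) * Real.log n ^ 2 := by
  have hC0 : 0 < entGapConst d p ((d : ℝ) ^ (p / 4)) := by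
    have hL := costLip_nonneg (d := d) hp
    have hd0 : (0 : ℝ) < d := by exact_mod_cast hd
    unfold entGapConst
    positivity
  set C₀ := entGapConst d p ((d : ℝ) ^ (p / 4)) with hC₀
  refine ⟨4 * C₀ ^ (1 / p), by positivity, ?_⟩
  intro n hn X Y hX hY hXc hYc μ ν hμP hνP hμX hνY g κhat hmk hsoft hopt
  have hn0 : n ≠ 0 := by omega
  have hn1 : (1 : ℝ) ≤ n := by exact_mod_cast (by omega : 1 ≤ n)
  have hnpos : (0 : ℝ) < n := by linarith
  have hd1 : (1 : ℝ) ≤ d := by exact_mod_cast hd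
  have hp0 : 0 < p := by linarith
  have hℓ : 1 ≤ Real.log n := by
    rw [Real.le_log_iff_exp_le hnpos]
    have h3 : (3 : ℝ) ≤ n := by exact_mod_cast hn
    linarith [Real.exp_one_lt_d9]
  set a : ℝ := 1 / max (2 * (d : ℝ)) 4 with ha
  set s : ℝ := (n : ℝ) ^ a with hs
  have hmax0 : (0 : ℝ) < max (2 * (d : ℝ)) 4 := lt_max_of_lt_right (by norm_num)
  have ha0 : 0 < a := by positivity
  have ha4 : a ≤ 1 / 4 := one_div_le_one_div_of_le (by norm_num) (le_max_right _ _)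
  have hs1 : 1 ≤ s := Real.one_le_rpow hn1 ha0.le
  have hs0 : 0 < s := by linarith
  have hsinv : (n : ℝ) ^ (-(1 : ℝ) / max (2 * (d : ℝ)) 4) = s⁻¹ := by
    rw [neg_div, Real.rpow_neg hnpos.le]
  have hsn : s ^ (2 * max d 2) = n := by
    rw [hs, ← Real.rpow_natCast, ← Real.rpow_mul hnpos.le]
    have : a * ((2 * max d 2 : ℕ) : ℝ) = 1 := by
      have h2 : ((2 * max d 2 : ℕ) : ℝ) = max (2 * (d : ℝ)) 4 := by
        push_cast
        rw [mul_max_of_nonneg _ _ (by norm_num)]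
        norm_num
      rw [h2, ha, one_div, inv_mul_cancel₀ hmax0.ne']
    rw [this, Real.rpow_one]
  have hD : 1 ≤ (d : ℝ) ^ (p / 4) := Real.one_le_rpow hd1 (by positivity)
  have hsℓ : 2 * Real.log s ≤ Real.log 2 * Real.log n := by
    rw [hs, Real.log_rpow hnpos]
    nlinarith [Real.log_two_gt_d9]
  obtain ⟨j, J, hjJ⟩ := exists_scales_entGap_bound_le (le_max_left d 2) (le_max_right d 2) hp hs1
    hℓ hsℓ hD
  rw [hsn] at hjJ
  simp only [hsinv] at hsoft hopt
  set τ : ℝ := (d : ℝ) ^ (p / 4) * s⁻¹ * Real.log n with hτdef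
  have hτ : 0 < τ := by positivity
  have hb : (0 : ℝ) < C₀ * s⁻¹ * Real.log n ^ 2 := by positivity
  set b := C₀ * s⁻¹ * Real.log n ^ 2 with hbdef
  set P := (Measure.pi fun _ : Fin n => μ).prod (Measure.pi fun _ : Fin n => ν) with hP
  have hZi : Integrable (fun ω : (Fin n → Rd d) × (Fin n → Rd d) =>
      entGap p τ j J μ ν ω.1 ω.2) P := integrable_entGap hn0 p τ j J
  have hZb : ∫ ω, entGap p τ j J μ ν ω.1 ω.2 ∂P ≤ b :=
    (integral_entGap_le hn0 hp hτ j J).trans hjJ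
  have hμc : ∀ᵐ x ∂μ, x ∈ cube01 d :=
    Filter.mem_of_superset (mem_ae_iff.2 ((prob_compl_eq_zero_iff hX).2 hμX)) hXc
  have hνc : ∀ᵐ x ∂ν, x ∈ cube01 d :=
    Filter.mem_of_superset (mem_ae_iff.2 ((prob_compl_eq_zero_iff hY).2 hνY)) hYc
  have hxs : ∀ᵐ ω ∂P, ∀ i, ω.1 i ∈ cube01 d :=
    Measure.quasiMeasurePreserving_fst.ae (ae_pi_forall_mem hμc)
  have hys : ∀ᵐ ω ∂P, ∀ i, ω.2 i ∈ cube01 d :=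
    Measure.quasiMeasurePreserving_snd.ae (ae_pi_forall_mem hνc)
  have hEp : ∀ᵐ ω ∂P, Ep p (κhat ω.1 ω.2) μ ν ≤
      2 * (b ^ (1 / p) * (1 + entGap p τ j J μ ν ω.1 ω.2 / b)) := by
    filter_upwards [hxs, hys] with ω h1 h2
    have := hmk ω.1 ω.2
    refine (Ep_le_two_mul_entGap_rpow hn0 hp hτ h1 h2 hμc hνc (hsoft ω.1 ω.2)
      (hopt ω.1 ω.2).1 (hopt ω.1 ω.2).2 j J).trans ?_
    gcongr
    exact rpow_one_div_le_mul_one_add hp (entGap_nonneg hp hτ j J) hb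
  have hbound : ∫ ω, Ep p (κhat ω.1 ω.2) μ ν ∂P ≤ 4 * b ^ (1 / p) := by
    by_cases hi : Integrable (fun ω => Ep p (κhat ω.1 ω.2) μ ν) P
    · have hdom : Integrable (fun ω : (Fin n → Rd d) × (Fin n → Rd d) =>
          2 * (b ^ (1 / p) * (1 + entGap p τ j J μ ν ω.1 ω.2 / b))) P :=
        (((integrable_const _).add (hZi.div_const _)).const_mul _).const_mul _
      refine (integral_mono_ae hi hdom hEp).trans ?_
      rw [integral_const_mul, integral_const_mul,
        integral_add (integrable_const _) (hZi.div_const _), integral_div]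
      simp only [integral_const, probReal_univ, smul_eq_mul, one_mul]
      have h1 : (∫ ω, entGap p τ j J μ ν ω.1 ω.2 ∂P) / b ≤ 1 := (div_le_one hb).2 hZb
      have h2 : 0 ≤ b ^ (1 / p) := by positivity
      nlinarith
    · rw [integral_undef hi]; positivity
  refine hbound.trans ?_
  have hrate : (n : ℝ) ^ (-(1 : ℝ) / max (2 * p * (d : ℝ)) (4 * p)) = (s⁻¹) ^ (1 / p) := by
    rw [← hsinv, ← Real.rpow_mul hnpos.le]
    congr 1
    have : max (2 * p * (d : ℝ)) (4 * p) = max (2 * (d : ℝ)) 4 * p := by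
      rw [max_mul_of_nonneg _ _ hp0.le]; ring_nf
    rw [this]
    field_simp
  have hlogp : (Real.log n ^ 2) ^ (1 / p) ≤ Real.log n ^ 2 := by
    have h1 : 1 / p ≤ 1 := by rw [div_le_one hp0]; exact hp
    have := Real.rpow_le_rpow_of_exponent_le (one_le_pow₀ hℓ : 1 ≤ Real.log n ^ 2) h1
    rwa [Real.rpow_one] at this
  rw [hrate, hbdef, Real.mul_rpow (by positivity) (by positivity),
    Real.mul_rpow (by positivity) (by positivity)]
  calc 4 * (C₀ ^ (1 / p) * s⁻¹ ^ (1 / p) * (Real.log n ^ 2) ^ (1 / p))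
      = 4 * C₀ ^ (1 / p) * s⁻¹ ^ (1 / p) * (Real.log n ^ 2) ^ (1 / p) := by ring
    _ ≤ _ := by gcongr
end
end

section
/- Let ν ∈ P(Y) with Y bounded and closed, let κ be a Markov kernel from X to Y, and let proj_{supp(ν)} denote the Euclidean metric projection onto the support of ν. Then for all μ ∈ P(X) with finite p-th moments, E_p(proj_{supp(ν)} ∘ κ; μ, ν) ≤ 4 E_p(κ; μ, ν). -/
open MeasureTheory ProbabilityTheory Set
open scoped ENNReal NNReal

noncomputable section

/-- The (topological) support of a measure: points all of whose open neighborhoods have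
positive measure. -/
def msupport {d : ℕ} (ν : Measure (Rd d)) : Set (Rd d) :=
  {y | ∀ U : Set (Rd d), IsOpen U → y ∈ U → 0 < ν U}

lemma ae_mem_msupport {d : ℕ} (ν : Measure (Rd d)) : ∀ᵐ y ∂ν, y ∈ msupport ν := by
  have h : (msupport ν) = ν.support := by
    ext y
    simp only [msupport, mem_ofPred_eq, Measure.mem_support_iff_forall]
    constructor
    · intro h U hU
      obtain ⟨V, hVU, hV, hy⟩ := mem_nhds_iff.1 hU
      exact (h V hV hy).trans_le (measure_mono hVU)
    · exact fun h U hU hy => h U (hU.mem_nhds hy)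
  rw [h]
  exact Measure.support_mem_ae

lemma msupport_subset_of_isClosed {d : ℕ} {ν : Measure (Rd d)} {Y : Set (Rd d)}
    (hY : IsClosed Y) (h : ∀ᵐ y ∂ν, y ∈ Y) : msupport ν ⊆ Y := by
  intro y hy
  by_contra hyY
  exact (hy Yᶜ hY.isOpen_compl hyY).ne' h

lemma MemLp.integral_norm_rpow_eq_toReal_eLpNorm {α E : Type*} [MeasurableSpace α]
    [NormedAddCommGroup E] {p : ℝ} (hp : 1 ≤ p) {m : Measure α} {g : α → E}
    (hg : MemLp g (ENNReal.ofReal p) m) :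
    (∫ z, ‖g z‖ ^ p ∂m) ^ (1 / p) = (eLpNorm g (ENNReal.ofReal p) m).toReal := by
  have hp0 : 0 < p := by linarith
  rw [hg.eLpNorm_eq_integral_rpow_norm (by simpa using hp0) (by simp),
    ENNReal.toReal_ofReal hp0.le, ENNReal.toReal_ofReal (by positivity), one_div]

lemma eLpNorm_sub_comp_map {α E : Type*} [MeasurableSpace α] [NormedAddCommGroup E]
    [MeasurableSpace E] [BorelSpace E] [SecondCountableTopology E] {m : Measure α} {g : α → E}
    (hg : Measurable g) {f : E → E} (hf : Measurable f) (q : ℝ≥0∞) :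
    eLpNorm (fun y => y - f y) q (m.map g) = eLpNorm (fun z => g z - f (g z)) q m :=
  eLpNorm_map_measure (measurable_id.sub hf).aestronglyMeasurable hg.aemeasurable

lemma Wp_le_of_coupling {d : ℕ} {p : ℝ} {μ ν : Measure (Rd d)} {π : Measure (Rd d × Rd d)}
    (hπ : IsCoupling π μ ν) : Wp p μ ν ≤ (∫ z, ‖z.1 - z.2‖ ^ p ∂π) ^ (1 / p) := by
  refine csInf_le ⟨0, ?_⟩ ⟨π, hπ, rfl⟩
  rintro _ ⟨π, -, rfl⟩
  positivity

lemma le_Wp {d : ℕ} {p c : ℝ} {μ ν : Measure (Rd d)} [IsProbabilityMeasure μ]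
    [IsProbabilityMeasure ν]
    (h : ∀ π, IsCoupling π μ ν → c ≤ (∫ z, ‖z.1 - z.2‖ ^ p ∂π) ^ (1 / p)) : c ≤ Wp p μ ν := by
  refine le_csInf ⟨_, μ.prod ν, ⟨?_, ?_⟩, rfl⟩ ?_
  · simp
  · simp
  · rintro _ ⟨π, hπ, rfl⟩
    exact h π hπ

lemma memLp_of_ae_mem_isBounded {α E : Type*} [MeasurableSpace α] [NormedAddCommGroup E]
    {m : Measure α} [IsFiniteMeasure m] {g : α → E} (hg : AEStronglyMeasurable g m) {Y : Set E}
    (hY : Bornology.IsBounded Y) (h : ∀ᵐ z ∂m, g z ∈ Y) (q : ℝ≥0∞) : MemLp g q m := by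
  obtain ⟨R, hR⟩ := hY.exists_norm_le
  exact MemLp.of_bound hg R (h.mono fun z hz => hR _ hz)

section NearestPoint

variable {d : ℕ} {p : ℝ} {Y : Set (Rd d)} {ρ ν : Measure (Rd d)} {f : Rd d → Rd d}

lemma coupling_memLp [IsProbabilityMeasure ρ] (hY : Bornology.IsBounded Y)
    (hρ : ∀ᵐ y ∂ρ, y ∈ Y) (hν : ∀ᵐ y ∂ν, y ∈ Y) {π : Measure (Rd d × Rd d)}
    (hπ : IsCoupling π ρ ν) (q : ℝ≥0∞) :
    MemLp Prod.fst q π ∧ MemLp Prod.snd q π := by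
  obtain ⟨h1, h2⟩ := hπ
  subst h1 h2
  have : IsProbabilityMeasure π := Measure.isProbabilityMeasure_of_map Prod.fst
  exact ⟨memLp_of_ae_mem_isBounded measurable_fst.aestronglyMeasurable hY
      (ae_of_ae_map measurable_fst.aemeasurable hρ) q,
    memLp_of_ae_mem_isBounded measurable_snd.aestronglyMeasurable hY
      (ae_of_ae_map measurable_snd.aemeasurable hν) q⟩

lemma eLpNorm_sub_nearest_le (hf : Measurable f)
    (hf_nearest : ∀ x : Rd d, ∀ y ∈ msupport ν, ‖x - f x‖ ≤ ‖x - y‖)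
    {π : Measure (Rd d × Rd d)} (hπ : IsCoupling π ρ ν) (q : ℝ≥0∞) :
    eLpNorm (fun y => y - f y) q ρ ≤ eLpNorm (fun z => z.1 - z.2) q π := by
  obtain ⟨h1, h2⟩ := hπ
  have hs : ∀ᵐ z ∂π, z.2 ∈ msupport ν := by
    refine ae_of_ae_map (f := Prod.snd) measurable_snd.aemeasurable ?_
    rw [h2]
    exact ae_mem_msupport ν
  rw [← h1, eLpNorm_sub_comp_map measurable_fst hf]
  exact eLpNorm_mono_ae (hs.mono fun z hz => hf_nearest z.1 z.2 hz)

/-- A nearest-point selection moves a measure by at most its distance to the target. -/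
lemma toReal_eLpNorm_sub_nearest_le_Wp [IsProbabilityMeasure ρ] [IsProbabilityMeasure ν]
    (hp : 1 ≤ p) (hY : Bornology.IsBounded Y)
    (hρ : ∀ᵐ y ∂ρ, y ∈ Y) (hν : ∀ᵐ y ∂ν, y ∈ Y) (hf : Measurable f)
    (hf_nearest : ∀ x : Rd d, ∀ y ∈ msupport ν, ‖x - f x‖ ≤ ‖x - y‖) :
    (eLpNorm (fun y => y - f y) (ENNReal.ofReal p) ρ).toReal ≤ Wp p ρ ν := by
  refine le_Wp fun π hπ => ?_
  obtain ⟨h1, h2⟩ := coupling_memLp hY hρ hν hπ (ENNReal.ofReal p)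
  have h12 := h1.sub h2
  rw [MemLp.integral_norm_rpow_eq_toReal_eLpNorm (g := fun z : Rd d × Rd d => z.1 - z.2) hp h12]
  exact ENNReal.toReal_mono h12.eLpNorm_ne_top (eLpNorm_sub_nearest_le hf hf_nearest hπ _)

lemma Wp_map_nearest_le [IsProbabilityMeasure ρ] [IsProbabilityMeasure ν]
    (hp : 1 ≤ p) (hY : Bornology.IsBounded Y)
    (hρ : ∀ᵐ y ∂ρ, y ∈ Y) (hν : ∀ᵐ y ∂ν, y ∈ Y) (hf : Measurable f) (hfY : ∀ x, f x ∈ Y)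
    (hf_nearest : ∀ x : Rd d, ∀ y ∈ msupport ν, ‖x - f x‖ ≤ ‖x - y‖) :
    Wp p (ρ.map f) ν ≤ 2 * Wp p ρ ν := by
  suffices h : Wp p (ρ.map f) ν / 2 ≤ Wp p ρ ν by linarith
  refine le_Wp fun π hπ => ?_
  have hq : (1 : ℝ≥0∞) ≤ ENNReal.ofReal p := by simpa using hp
  obtain ⟨h1, h2⟩ := coupling_memLp hY hρ hν hπ (ENNReal.ofReal p)
  have h12 : MemLp (fun z : Rd d × Rd d => z.1 - z.2) (ENNReal.ofReal p) π := h1.sub h2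
  have hD := eLpNorm_sub_nearest_le hf hf_nearest hπ (ENNReal.ofReal p)
  have hπp : IsProbabilityMeasure π := by
    have := hπ.1
    subst this
    exact Measure.isProbabilityMeasure_of_map Prod.fst
  have hf1 : MemLp (fun z : Rd d × Rd d => f z.1) (ENNReal.ofReal p) π :=
    memLp_of_ae_mem_isBounded (hf.comp measurable_fst).aestronglyMeasurable hY
      (Filter.Eventually.of_forall fun z => hfY _) _
  have hf12 : MemLp (fun z : Rd d × Rd d => f z.1 - z.2) (ENNReal.ofReal p) π := hf1.sub h2
  have hm : Measurable fun z : Rd d × Rd d => (f z.1, z.2) :=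
    (hf.comp measurable_fst).prodMk measurable_snd
  have hc : IsCoupling (π.map fun z => (f z.1, z.2)) (ρ.map f) ν := by
    constructor
    · rw [Measure.map_map measurable_fst hm, ← hπ.1, Measure.map_map hf measurable_fst]
      rfl
    · rw [Measure.map_map measurable_snd hm, ← hπ.2]
      rfl
  have hW := Wp_le_of_coupling (p := p) hc
  rw [integral_map hm.aemeasurable (Measurable.aestronglyMeasurable (by fun_prop))] at hW
  have e1 := MemLp.integral_norm_rpow_eq_toReal_eLpNorm hp hf12
  have e2 := MemLp.integral_norm_rpow_eq_toReal_eLpNorm hp h12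
  simp only at hW
  rw [e1] at hW
  rw [e2]
  have key : eLpNorm (fun z : Rd d × Rd d => f z.1 - z.2) (ENNReal.ofReal p) π ≤
      eLpNorm (fun z : Rd d × Rd d => z.1 - z.2) (ENNReal.ofReal p) π +
      eLpNorm (fun z : Rd d × Rd d => z.1 - z.2) (ENNReal.ofReal p) π := by
    have hfun : (fun z : Rd d × Rd d => f z.1 - z.2) =
        (fun z => z.1 - z.2) - (fun z => z.1 - f z.1) := by
      ext1 z
      simp
    rw [hfun]
    refine (eLpNorm_sub_le h12.1 (h1.sub hf1).1 hq).trans (add_le_add le_rfl ?_)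
    refine le_trans (le_of_eq ?_) hD
    rw [← hπ.1, eLpNorm_sub_comp_map measurable_fst hf]
    rfl
  have := ENNReal.toReal_mono (ENNReal.add_ne_top.2 ⟨h12.eLpNorm_ne_top, h12.eLpNorm_ne_top⟩) key
  rw [ENNReal.toReal_add h12.eLpNorm_ne_top h12.eLpNorm_ne_top] at this
  linarith

end NearestPoint

lemma kernelCost_eq_toReal_eLpNorm {d : ℕ} {p : ℝ} (hp : 1 ≤ p) {μ : Measure (Rd d)}
    [IsProbabilityMeasure μ] {κ : Kernel (Rd d) (Rd d)} [IsMarkovKernel κ] {f : Rd d → Rd d}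
    (hf : Measurable f)
    (h : MemLp (fun z => z.1 - f z.2) (ENNReal.ofReal p) (μ ⊗ₘ κ)) :
    kernelCost p (κ.map f) μ =
      (eLpNorm (fun z => z.1 - f z.2) (ENNReal.ofReal p) (μ ⊗ₘ κ)).toReal := by
  have hp0 : 0 < p := by linarith
  have hi := h.integrable_norm_rpow (by simpa using hp0) (by simp)
  rw [ENNReal.toReal_ofReal hp0.le] at hi
  rw [← MemLp.integral_norm_rpow_eq_toReal_eLpNorm hp h, kernelCost,
    Measure.integral_compProd hi]
  congr 2
  ext x
  rw [Kernel.map_apply _ hf, integral_map hf.aemeasurable]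
  exact Measurable.aestronglyMeasurable (by fun_prop)

/-- Composing a kernel with the metric projection onto the support of the
target measure at most quadruples the transportation error:
`E_p(proj_{supp(ν)} ∘ κ; μ, ν) ≤ 4 E_p(κ; μ, ν)`. -/
theorem ep_projection_composition {d : ℕ} (hd : 1 ≤ d) {p : ℝ} (hp : 1 ≤ p)
    (X Y : Set (Rd d)) (hX : MeasurableSet X) (hY : MeasurableSet Y)
    (hYbdd : Bornology.IsBounded Y) (hYclosed : IsClosed Y)
    (μ ν : Measure (Rd d)) [IsProbabilityMeasure μ] [IsProbabilityMeasure ν]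
    (hμX : μ X = 1) (hνY : ν Y = 1) (hμmom : HasFiniteMoment p μ)
    (κ : Kernel (Rd d) (Rd d)) [IsMarkovKernel κ] (hκY : ∀ x ∈ X, κ x Y = 1)
    -- `f` is a measurable selection of nearest points in `supp(ν)`
    (f : Rd d → Rd d) (hf : Measurable f)
    (hf_mem : ∀ x, f x ∈ msupport ν)
    (hf_nearest : ∀ x : Rd d, ∀ y ∈ msupport ν, ‖x - f x‖ ≤ ‖x - y‖) :
    Ep p (Kernel.map κ f) μ ν ≤ 4 * Ep p κ μ ν := by
  have hp0 : 0 < p := by linarith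
  have hq : (1 : ℝ≥0∞) ≤ ENNReal.ofReal p := by simpa using hp
  have hν : ∀ᵐ y ∂ν, y ∈ Y := (mem_ae_iff_prob_eq_one hY).2 hνY
  have hfY : ∀ x, f x ∈ Y := fun x => msupport_subset_of_isClosed hYclosed hν (hf_mem x)
  have hκ : ∀ᵐ z ∂(μ ⊗ₘ κ), z.2 ∈ Y := by
    rw [Measure.ae_compProd_iff (measurable_snd hY)]
    filter_upwards [(mem_ae_iff_prob_eq_one hX).2 hμX] with x hx
    exact (mem_ae_iff_prob_eq_one hY).2 (hκY x hx)
  have hsnd : (μ ⊗ₘ κ).map Prod.snd = kpush κ μ := Measure.snd_compProd μ κ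
  have hρp : IsProbabilityMeasure (kpush κ μ) := by
    rw [← hsnd]
    exact Measure.isProbabilityMeasure_map measurable_snd.aemeasurable
  have hρ : ∀ᵐ y ∂(kpush κ μ), y ∈ Y := by
    rw [← hsnd]
    exact (ae_map_iff measurable_snd.aemeasurable hY).2 hκ
  have hpush : kpush (κ.map f) μ = (kpush κ μ).map f := (Measure.map_comp μ κ hf).symm
  have hD := toReal_eLpNorm_sub_nearest_le_Wp hp hYbdd hρ hν hf hf_nearest
  have hW := Wp_map_nearest_le hp hYbdd hρ hν hf hfY hf_nearest
  have hid : MemLp (fun x : Rd d => x) (ENNReal.ofReal p) μ := by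
    rw [← integrable_norm_rpow_iff (f := fun x : Rd d => x) (p := ENNReal.ofReal p)
      measurable_id.aestronglyMeasurable (by simpa using hp0) (by simp),
      ENNReal.toReal_ofReal hp0.le]
    exact hμmom
  have h1 : MemLp (fun z : Rd d × Rd d => z.1) (ENNReal.ofReal p) (μ ⊗ₘ κ) := by
    have hfst : (μ ⊗ₘ κ).map Prod.fst = μ := Measure.fst_compProd μ κ
    rw [← hfst] at hid
    exact hid.comp_of_map measurable_fst.aemeasurable
  have h2 : MemLp (fun z : Rd d × Rd d => z.2) (ENNReal.ofReal p) (μ ⊗ₘ κ) :=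
    memLp_of_ae_mem_isBounded measurable_snd.aestronglyMeasurable hYbdd hκ _
  have h3 : MemLp (fun z : Rd d × Rd d => f z.2) (ENNReal.ofReal p) (μ ⊗ₘ κ) :=
    memLp_of_ae_mem_isBounded (hf.comp measurable_snd).aestronglyMeasurable hYbdd
      (Filter.Eventually.of_forall fun z => hfY _) _
  have hcost : kernelCost p (κ.map f) μ ≤ kernelCost p κ μ +
      (eLpNorm (fun y => y - f y) (ENNReal.ofReal p) (kpush κ μ)).toReal := by
    have h12 : MemLp (fun z : Rd d × Rd d => z.1 - z.2) (ENNReal.ofReal p) (μ ⊗ₘ κ) := h1.sub h2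
    have h23 : MemLp (fun z : Rd d × Rd d => z.2 - f z.2) (ENNReal.ofReal p) (μ ⊗ₘ κ) := h2.sub h3
    have e := kernelCost_eq_toReal_eLpNorm hp measurable_id h12
    simp only [Kernel.map_id, id_eq] at e
    rw [kernelCost_eq_toReal_eLpNorm hp hf (h1.sub h3), e, ← hsnd,
      eLpNorm_sub_comp_map measurable_snd hf,
      ← ENNReal.toReal_add h12.eLpNorm_ne_top h23.eLpNorm_ne_top]
    refine ENNReal.toReal_mono (ENNReal.add_ne_top.2
      ⟨h12.eLpNorm_ne_top, h23.eLpNorm_ne_top⟩) ?_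
    have hfun : (fun z : Rd d × Rd d => z.1 - f z.2) =
        (fun z => z.1 - z.2) + (fun z => z.2 - f z.2) := by
      ext1 z
      simp
    rw [hfun]
    exact eLpNorm_add_le h12.1 h23.1 hq
  have hW0 : 0 ≤ Wp p (kpush κ μ) ν := ENNReal.toReal_nonneg.trans hD
  have hgap := le_max_left (kernelCost p κ μ - Wp p μ ν) 0
  have hgap0 := le_max_right (kernelCost p κ μ - Wp p μ ν) 0
  have hgap' : max (kernelCost p (κ.map f) μ - Wp p μ ν) 0 ≤
      max (kernelCost p κ μ - Wp p μ ν) 0 + Wp p (kpush κ μ) ν :=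
    max_le (by linarith) (by linarith)
  rw [Ep, Ep, hpush]
  linarith
end
end
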